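/- arXiv:1708.04635 — 4 statements merged into one kernel-verified Lean document; each statement's English description precedes it below -/
import Mathlib

section
/- Let R be a Noetherian commutative ring, N a finitely generated R-module, and I an ideal of R that is not contained in any minimal prime ideal over Ann_R N. Then the sequence of sets Ass_R (I^n)^{(N)}_a/((I + Ann_R N)^n)_a, n = 1, 2, …, is increasing and ultimately constant. -/
open Pointwise

section Defs

variable {R : Type} [CommRing R]

/-- `x` is integrally dependent on the ideal `I` relative to the module `N`:
`x ^ n • N ⊆ ∑_{i=1}^n x^(n-i) • (I^i • N)` for some `n ≥ 1`. -/
def Ideal.RelIntDep (I : Ideal R) (N : Type) [AddCommGroup N] [Module R N] (x : R) : Prop :=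
  ∃ n : ℕ, 0 < n ∧ ∀ m : N, x ^ n • m ∈
    ⨆ i ∈ Finset.Icc 1 n, x ^ (n - i) • (I ^ i • (⊤ : Submodule R N))

/-- The integral closure `I^{(N)}_a` of `I` relative to `N`, as a subset of `R`. -/
def Ideal.relIntClosure (I : Ideal R) (N : Type) [AddCommGroup N] [Module R N] : Set R :=
  {x | I.RelIntDep N x}

/-- The classical integral closure `I_a` of an ideal, as a subset of `R`. -/
def Ideal.intClosure (I : Ideal R) : Set R :=
  {x | ∃ n : ℕ, 0 < n ∧ ∃ r : ℕ → R, (∀ i ∈ Finset.Icc 1 n, r i ∈ I ^ i) ∧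
    x ^ n + ∑ i ∈ Finset.Icc 1 n, r i * x ^ (n - i) = 0}

/-- `mAss_R N`: the set of minimal members of `Ass_R N`. -/
def mAss (R : Type) [CommRing R] (N : Type) [AddCommGroup N] [Module R N] : Set (Ideal R) :=
  {p | Minimal (· ∈ associatedPrimes R N) p}

/-- `Ass_R (R/J)` for a subset `J ⊆ R`: primes of the form `(J :_R x)`. -/
def assQuot (J : Set R) : Set (Ideal R) :=
  {p | p.IsPrime ∧ ∃ x : R, (p : Set R) = {r : R | r * x ∈ J}}

/-- `Ass_R (J/K)` for subsets `K ⊆ J` of `R`: primes of the form `(K :_R x)` with `x ∈ J`. -/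
def assQuot₂ (J K : Set R) : Set (Ideal R) :=
  {p | p.IsPrime ∧ ∃ x ∈ J, (p : Set R) = {r : R | r * x ∈ K}}

/-- `S(J) = ∪_{s ∈ S} (J :_R s)`. -/
def sat (S : Set R) (J : Set R) : Set R := {x | ∃ s ∈ S, s * x ∈ J}

/-- `(J :_R K)` for subsets of `R`. -/
def setColon (J K : Set R) : Set R := {x | ∀ y ∈ K, x * y ∈ J}

/-- `(J :_R ⟨K⟩) = ∪_{n ≥ 1} (J :_R K^n)`. -/
def colonPow (J : Set R) (K : Ideal R) : Set R :=
  {x | ∃ n : ℕ, 0 < n ∧ ∀ y ∈ K ^ n, x * y ∈ J}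

end Defs

namespace Ideal

variable {R : Type} [CommRing R]

theorem sup_pow_le_of_forall {D X E : Ideal R} {N : ℕ}
    (h : ∀ a b, a + b = N → D ^ a * X ^ b ≤ E) : (D ⊔ X) ^ N ≤ E := by
  rw [← Submodule.add_eq_sup, add_pow]
  refine Finset.sum_induction _ (· ≤ E) (fun _ _ ↦ sup_le) bot_le fun a ha ↦ ?_
  exact Ideal.mul_le_left.trans (h a (N - a) (by have := Finset.mem_range.1 ha; omega))

theorem mem_intClosure_iff {J : Ideal R} {x : R} :
    x ∈ J.intClosure ↔ ∃ n : ℕ, 0 < n ∧ x ^ n ∈ J * (J ⊔ span {x}) ^ (n - 1) := by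
  constructor
  · rintro ⟨n, hn, r, hr, h⟩
    refine ⟨n, hn, ?_⟩
    rw [eq_neg_of_add_eq_zero_left h]
    refine neg_mem (sum_mem _ fun i hi ↦ ?_)
    have h1 := Finset.mem_Icc.1 hi
    have h2 := hr i hi
    obtain ⟨i, rfl⟩ : ∃ k, i = k + 1 := ⟨i - 1, by omega⟩
    have h3 : J * (J ^ i * span {x} ^ (n - (i + 1))) ≤ J * (J ⊔ span {x}) ^ (n - 1) := by
      refine mul_mono_right ?_
      calc _ ≤ (J ⊔ span {x}) ^ i * (J ⊔ span {x}) ^ (n - (i + 1)) :=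
            mul_mono (pow_right_mono le_sup_left _) (pow_right_mono le_sup_right _)
        _ = _ := by rw [← pow_add]; congr 1; omega
    apply h3
    rw [← mul_assoc, ← pow_succ']
    exact mul_mem_mul h2 (pow_mem_pow (mem_span_singleton_self x) _)
  · rintro ⟨n, hn, h⟩
    have key : J * (J ⊔ span {x}) ^ (n - 1) ≤
        ⨆ i ∈ Finset.Icc 1 n, J ^ i * span {x ^ (n - i)} := by
      rw [mul_le]
      intro a ha b hb
      have : (J ⊔ span {x}) ^ (n - 1) ≤
          Submodule.comap (LinearMap.mul R R a)
            (⨆ i ∈ Finset.Icc 1 n, J ^ i * span {x ^ (n - i)}) := by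
        refine sup_pow_le_of_forall fun k l hkl ↦ mul_le.2 fun c hc d hd ↦ ?_
        refine Submodule.mem_iSup_of_mem (k + 1) (Submodule.mem_iSup_of_mem
          (Finset.mem_Icc.2 ⟨by omega, by omega⟩) ?_)
        rw [LinearMap.mul_apply', ← mul_assoc, show n - (k + 1) = l by omega, pow_succ',
          ← span_singleton_pow]
        exact mul_mem_mul (mul_mem_mul ha hc) hd
      exact this hb
    obtain ⟨μ, hμ⟩ := (Submodule.mem_iSup_finset_iff_exists_sum _ _).1 (key h)
    choose z hz hz' using fun i ↦ mem_mul_span_singleton.1 (μ i).2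
    refine ⟨n, hn, fun i ↦ -z i, fun i _ ↦ neg_mem (hz i), ?_⟩
    simp only [neg_mul, hz', Finset.sum_neg_distrib, hμ, add_neg_cancel]

theorem mul_mem_intClosure {J J' : Ideal R} {b x : R} (hb : ∀ a ∈ J, b * a ∈ J')
    (hx : x ∈ J.intClosure) : b * x ∈ J'.intClosure := by
  obtain ⟨n, hn, r, hr, h⟩ := hx
  refine ⟨n, hn, fun i ↦ b ^ i * r i, fun i hi ↦ ?_, ?_⟩
  · have h1 : span {b} * J ≤ J' := by
      rw [span_singleton_mul_le_iff]
      exact hb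
    refine pow_right_mono h1 i ?_
    rw [mul_pow]
    exact mul_mem_mul (pow_mem_pow (mem_span_singleton_self b) _) (hr i hi)
  · rw [← mul_zero (b ^ n), ← h, mul_add, mul_pow, Finset.mul_sum]
    congr 1
    refine Finset.sum_congr rfl fun i hi ↦ ?_
    have h1 : b ^ n = b ^ i * b ^ (n - i) := by
      rw [← pow_add]; congr 1; have := Finset.mem_Icc.1 hi; omega
    rw [h1, mul_pow]
    ring

/-- The determinant trick, for a module (here: an ideal) with nilpotent annihilator. -/
theorem mem_intClosure_of_mul_le {J M : Ideal R} (hM : M.FG) {y : R}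
    (hy : ∀ a ∈ M, y * a ∈ J * M)
    (hann : ∀ d : R, (∀ a ∈ M, d * a = 0) → IsNilpotent d) : y ∈ J.intClosure := by
  have : Module.Finite R M := Module.Finite.iff_fg.2 hM
  obtain ⟨p, hp, -, hpJ, hp0⟩ :=
    LinearMap.exists_monic_and_natDegree_eq_and_coeff_mem_pow_and_aeval_eq_zero R
      (algebraMap R (Module.End R M) y) J (by
        rintro _ ⟨a, rfl⟩
        have h1 : (y * (a : R)) ∈ (J • (⊤ : Submodule R M)).map M.subtype := by
          rw [Submodule.map_smul'', Submodule.map_top, Submodule.range_subtype]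
          exact hy a a.2
        obtain ⟨b, hb, hb'⟩ := h1
        have h2 : algebraMap R (Module.End R M) y a = b := Subtype.ext hb'.symm
        rw [h2]
        exact hb)
  set N := p.natDegree with hN
  have hd : ∀ a ∈ M, p.eval y * a = 0 := fun a ha ↦ by
    rw [Polynomial.aeval_algebraMap_apply, Polynomial.coe_aeval_eq_eval] at hp0
    simpa using congrArg Subtype.val (LinearMap.congr_fun hp0 (⟨a, ha⟩ : M))
  obtain ⟨e, he⟩ := hann _ hd
  set D := J ⊔ span {y}
  have hyD : y ∈ D := le_sup_right (a := J) (mem_span_singleton_self y)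
  have h1 : y ^ (N + 1) - y * p.eval y ∈ J * D ^ N := by
    rw [Polynomial.eval_eq_sum_range, Finset.sum_range_succ, hp.coeff_natDegree, mul_add, ← hN,
      one_mul, ← pow_succ', sub_add_cancel_right, Finset.mul_sum]
    refine neg_mem (sum_mem _ fun i hi ↦ ?_)
    have hi := Finset.mem_range.1 hi
    have h2 := hpJ i
    rw [show p.natDegree - i = (N - i - 1) + 1 by omega, pow_succ'] at h2
    have h3 : J * J ^ (N - i - 1) * D ^ (i + 1) ≤ J * D ^ N := by
      rw [mul_assoc]
      refine mul_mono_right ?_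
      calc _ ≤ D ^ (N - i - 1) * D ^ (i + 1) := mul_mono_left (pow_right_mono le_sup_left _)
        _ = _ := by rw [← pow_add]; congr 1; omega
    apply h3
    rw [mul_left_comm, ← pow_succ' y]
    exact mul_mem_mul h2 (pow_mem_pow hyD _)
  have h2 : y * p.eval y ∈ D ^ (N + 1) := by
    have h3 : J * D ^ N ≤ D ^ (N + 1) := by
      rw [pow_succ']; exact mul_mono_left le_sup_left
    simpa using sub_mem (pow_mem_pow hyD (N + 1)) (h3 h1)
  have h3 : ∀ k : ℕ, (y ^ (N + 1)) ^ (k + 1) - (y * p.eval y) ^ (k + 1) ∈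
      J * D ^ ((N + 1) * (k + 1) - 1) := by
    intro k
    induction k with
    | zero => simpa using h1
    | succ k ih =>
      have e1 : (y ^ (N + 1)) ^ (k + 1 + 1) - (y * p.eval y) ^ (k + 1 + 1) =
          ((y ^ (N + 1)) ^ (k + 1) - (y * p.eval y) ^ (k + 1)) * y ^ (N + 1) +
            (y ^ (N + 1) - y * p.eval y) * (y * p.eval y) ^ (k + 1) := by ring
      rw [e1]
      have e2 : (N + 1) * (k + 1 + 1) - 1 = (N + 1) * (k + 1) - 1 + (N + 1) := by
        rw [mul_add (N + 1) (k + 1)]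
        have : 0 < (N + 1) * (k + 1) := by positivity
        omega
      have e3 : (N + 1) * (k + 1 + 1) - 1 = N + (N + 1) * (k + 1) := by
        rw [mul_add (N + 1) (k + 1)]
        omega
      refine add_mem ?_ ?_
      · rw [e2, pow_add, ← mul_assoc]
        exact mul_mem_mul ih (pow_mem_pow hyD _)
      · rw [e3, pow_add, ← mul_assoc, pow_mul]
        exact mul_mem_mul h1 (pow_mem_pow h2 _)
  refine mem_intClosure_iff.2 ⟨(N + 1) * (e + 1), by positivity, ?_⟩
  have := h3 e
  rwa [mul_pow, pow_succ (p.eval y), he, zero_mul, mul_zero, sub_zero, ← pow_mul] at this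

/-- Adjoining finitely many integral elements to `J` yields an ideal of which `J` is a
reduction. -/
theorem exists_pow_succ_le_mul_pow_of_subset_intClosure {J : Ideal R} (T : Finset R)
    (h : ∀ c ∈ T, c ∈ J.intClosure) :
    ∃ k : ℕ, (J ⊔ span (T : Set R)) ^ (k + 1) ≤ J * (J ⊔ span (T : Set R)) ^ k := by
  classical
  induction T using Finset.induction_on with
  | empty => exact ⟨0, by simp⟩
  | insert x T _ ih =>
    obtain ⟨k, hk⟩ := ih fun c hc ↦ h c (Finset.mem_insert_of_mem hc)
    obtain ⟨n, hn, hx⟩ := mem_intClosure_iff.1 (h x (Finset.mem_insert_self _ _))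
    have e : J ⊔ span ((insert x T : Finset R) : Set R) = (J ⊔ span (T : Set R)) ⊔ span {x} := by
      rw [Finset.coe_insert, span_insert, sup_comm (span {x}), sup_assoc]
    rw [e]
    set E := J ⊔ span (T : Set R)
    refine ⟨k + n, sup_pow_le_of_forall fun a b hab ↦ ?_⟩
    by_cases ha : k + 1 ≤ a
    · obtain ⟨m, rfl⟩ := Nat.exists_eq_add_of_le ha
      calc _ ≤ (J * E ^ k) * E ^ m * span {x} ^ b := by
            rw [pow_add]; exact mul_mono_left (mul_mono_left hk)
        _ = J * (E ^ (k + m) * span {x} ^ b) := by rw [pow_add]; ring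
        _ ≤ J * ((E ⊔ span {x}) ^ (k + m) * (E ⊔ span {x}) ^ b) :=
            mul_mono_right (mul_mono (pow_right_mono le_sup_left _)
              (pow_right_mono le_sup_right _))
        _ = _ := by rw [← pow_add]; congr 2; omega
    · obtain ⟨m, rfl⟩ := Nat.exists_eq_add_of_le (show n ≤ b by omega)
      have hx' : span {x} ^ n ≤ J * (J ⊔ span {x}) ^ (n - 1) := by
        rwa [span_singleton_pow, span_singleton_le_iff_mem]
      calc _ ≤ E ^ a * ((J * (J ⊔ span {x}) ^ (n - 1)) * span {x} ^ m) := by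
            rw [pow_add]; exact mul_mono_right (mul_mono_left hx')
        _ = J * (E ^ a * (J ⊔ span {x}) ^ (n - 1) * span {x} ^ m) := by ring
        _ ≤ J * ((E ⊔ span {x}) ^ a * (E ⊔ span {x}) ^ (n - 1) * (E ⊔ span {x}) ^ m) :=
            mul_mono_right (mul_mono (mul_mono (pow_right_mono le_sup_left _)
              (pow_right_mono (sup_le_sup_right le_sup_left _) _))
              (pow_right_mono le_sup_right _))
        _ = _ := by rw [← pow_add, ← pow_add]; congr 2; omega

theorem mem_intClosure_of_pow_mul_mem [IsNoetherianRing R] {J : Ideal R}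
    (hann : ∀ (l : ℕ) (d : R), (∀ a ∈ J ^ l, d * a = 0) → IsNilpotent d) {y : R} {k : ℕ}
    (hy : ∀ m, y ^ (k + m) ∈ J ^ m) : y ∈ J.intClosure := by
  set D := J ⊔ span {y}
  have h1 : ∀ m, J ^ k * D ^ m ≤ J ^ m := fun m ↦ by
    rw [mul_le]
    intro a ha b hb
    have : D ^ m ≤ Submodule.comap (LinearMap.mul R R a) (J ^ m) := by
      refine sup_pow_le_of_forall fun i j hij ↦ mul_le.2 fun c hc d hd ↦ ?_
      change a * (c * d) ∈ J ^ m
      rw [mul_left_comm, ← hij, pow_add]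
      refine mul_mem_mul hc ?_
      rw [span_singleton_pow, mem_span_singleton'] at hd
      obtain ⟨d, rfl⟩ := hd
      rw [mul_left_comm]
      refine mul_mem_left _ _ ?_
      obtain hjk | hjk := le_total j k
      · exact mul_mem_right _ _ (pow_le_pow_right hjk ha)
      · obtain ⟨t, rfl⟩ := Nat.exists_eq_add_of_le hjk
        rw [pow_add J]
        exact mul_mem_mul ha (hy t)
    exact this hb
  let F : J.Filtration R :=
    { N := fun m ↦ J ^ k * D ^ m
      mono := fun m ↦ mul_mono_right (pow_le_pow_right m.le_succ)
      smul_le := fun m ↦ by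
        change J * (J ^ k * D ^ m) ≤ J ^ k * D ^ (m + 1)
        rw [mul_left_comm, pow_succ']
        exact mul_mono_right (mul_mono_left le_sup_left) }
  obtain ⟨m, hm⟩ := (J.stableFiltration_stable (⊤ : Ideal R)).of_le (F' := F) fun m ↦ by
    change J ^ k * D ^ m ≤ J ^ m • (⊤ : Ideal R)
    simpa using h1 m
  have hm : J * (J ^ k * D ^ m) = J ^ k * D ^ (m + 1) := hm m le_rfl
  refine mem_intClosure_of_mul_le (M := J ^ k * D ^ m) (IsNoetherian.noetherian _)
    (fun a ha ↦ ?_) fun d hd ↦ hann (k + m) d fun a ha ↦ hd a ?_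
  · rw [hm, pow_succ', mul_left_comm]
    exact mul_mem_mul (le_sup_right (a := J) (mem_span_singleton_self y)) ha
  · rw [pow_add] at ha
    exact mul_mono_right (pow_right_mono le_sup_left _) ha

end Ideal

section Contraction

variable {R A M : Type*} [CommRing R] [CommRing A] [Algebra R A] [IsNoetherianRing A]
  [AddCommGroup M] [Module A M] {p : Ideal R} [hp : p.IsPrime]

theorem exists_mem_associatedPrimes_comap_eq {y : M} {j : ℕ}
    (hj : ∀ a ∈ p ^ j, algebraMap R A a • y = 0) (hy : ∀ s ∉ p, algebraMap R A s • y ≠ 0) :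
    ∃ P ∈ associatedPrimes A M, P.comap (algebraMap R A) = p := by
  let T : Set M := {y | (∀ a ∈ p ^ j, algebraMap R A a • y = 0) ∧
    ∀ s ∉ p, algebraMap R A s • y ≠ 0}
  let ann : M → Ideal A := fun y ↦ (⊥ : Submodule A M).colon {y}
  have mem_ann : ∀ {a y}, a ∈ ann y ↔ a • y = 0 := fun {a y} ↦ by
    simp [ann, Submodule.mem_colon_singleton]
  obtain ⟨_, ⟨y, ⟨hyj, hys⟩, rfl⟩, hmax⟩ :=
    set_has_maximal_iff_noetherian.2 (inferInstance : IsNoetherian A A) (ann '' T)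
      ⟨_, y, ⟨hj, hy⟩, rfl⟩
  have key : ∀ b : A, (∀ s ∉ p, algebraMap R A s • b • y ≠ 0) → ∀ a : A, a • b • y = 0 → a • y = 0 := by
    intro b hb a ha
    have h1 : ann y ≤ ann (b • y) := fun c hc ↦ by
      rw [mem_ann] at hc ⊢
      rw [smul_comm, hc, smul_zero]
    have h2 := hmax _ ⟨b • y, ⟨fun c hc ↦ by rw [smul_comm, hyj c hc, smul_zero], hb⟩, rfl⟩
    have h3 : ann y = ann (b • y) := by_contra fun h ↦ h2 (lt_of_le_of_ne h1 h)
    rw [← mem_ann, h3, mem_ann]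
    exact ha
  have hprime : (ann y).IsPrime := by
    refine ⟨fun h ↦ ?_, fun {a b} hab ↦ ?_⟩
    · refine hys 1 (fun h1 ↦ hp.ne_top (p.eq_top_iff_one.2 h1)) ?_
      rw [map_one, ← mem_ann, h]
      trivial
    · simp only [mem_ann] at hab ⊢
      by_contra! h
      by_cases hb : ∀ s ∉ p, algebraMap R A s • b • y ≠ 0
      · exact h.1 (key b hb a (by rwa [← mul_smul]))
      · push Not at hb
        obtain ⟨s, hs, hsb⟩ := hb
        refine h.2 (key (algebraMap R A s) (fun t ht h0 ↦ ?_) b (by rwa [smul_comm]))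
        rw [← mul_smul, ← map_mul] at h0
        exact hys _ (fun hts ↦ (hp.mem_or_mem hts).elim ht hs) h0
  refine ⟨ann y, isAssociatedPrime_iff.2 ⟨hprime, y, rfl⟩, le_antisymm (fun r hr ↦ ?_) ?_⟩
  · by_contra h
    exact hys r h (mem_ann.1 hr)
  · have := hprime.comap (algebraMap R A)
    exact this.le_of_pow_le (n := j) fun a ha ↦ mem_ann.2 (hyj a ha)

/-- If `p` is not contracted from an associated prime of `M`, a single element outside `p` kills
all the `p`-power torsion of `M`. -/
theorem exists_notMem_forall_smul_eq_zero [Module.Finite A M]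
    (h : p ∉ Ideal.comap (algebraMap R A) '' associatedPrimes A M) :
    ∃ s ∉ p, ∀ y : M, (∃ j : ℕ, ∀ a ∈ p ^ j, algebraMap R A a • y = 0) →
      algebraMap R A s • y = 0 := by
  let H : Submodule A M :=
    { carrier := {y | ∃ j : ℕ, ∀ a ∈ p ^ j, algebraMap R A a • y = 0}
      zero_mem' := ⟨0, fun a _ ↦ smul_zero _⟩
      add_mem' := by
        rintro x y ⟨j, hj⟩ ⟨k, hk⟩
        refine ⟨j + k, fun a ha ↦ ?_⟩
        rw [smul_add, hj a (Ideal.pow_le_pow_right (by omega) ha),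
          hk a (Ideal.pow_le_pow_right (by omega) ha), add_zero]
      smul_mem' := by
        rintro c x ⟨j, hj⟩
        exact ⟨j, fun a ha ↦ by rw [smul_comm, hj a ha, smul_zero]⟩ }
  have key : ∀ L : Submodule A M, L.FG → L ≤ H → ∃ s ∉ p, ∀ y ∈ L, algebraMap R A s • y = 0 := by
    intro L hL
    induction L, hL using Submodule.fg_induction with
    | singleton x =>
      intro hx
      obtain ⟨j, hj⟩ := hx (Submodule.mem_span_singleton_self x)
      by_contra! hs
      refine h (exists_mem_associatedPrimes_comap_eq hj fun s hsp h0 ↦ ?_)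
      obtain ⟨y, hy, hy0⟩ := hs s hsp
      obtain ⟨c, rfl⟩ := Submodule.mem_span_singleton.1 hy
      exact hy0 (by rw [smul_comm, h0, smul_zero])
    | sup L₁ L₂ h₁ h₂ ih₁ ih₂ =>
      intro hx
      obtain ⟨s, hs, hs'⟩ := ih₁ (le_sup_left.trans hx)
      obtain ⟨t, ht, ht'⟩ := ih₂ (le_sup_right.trans hx)
      refine ⟨s * t, fun hst ↦ (hp.mem_or_mem hst).elim hs ht, fun y hy ↦ ?_⟩
      obtain ⟨u, hu, v, hv, rfl⟩ := Submodule.mem_sup.1 hy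
      rw [map_mul, smul_add, mul_smul, mul_smul, ht' v hv, smul_comm, hs' u hu, smul_zero,
        smul_zero, add_zero]
  obtain ⟨s, hs, hs'⟩ := key H (IsNoetherian.noetherian H) le_rfl
  exact ⟨s, hs, fun y hy ↦ hs' y hy⟩

variable (R) in
/-- The contractions to `R` of the associated primes of `A ⧸ Q`. -/
def Ideal.contractedPrimes (Q : Ideal A) : Set (Ideal R) :=
  Ideal.comap (algebraMap R A) '' associatedPrimes A (A ⧸ Q)

variable (R) in
theorem Ideal.finite_contractedPrimes (Q : Ideal A) : (Q.contractedPrimes R).Finite :=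
  (associatedPrimes.finite _ _).image _

theorem Ideal.exists_notMem_forall_mul_mem {Q : Ideal A} (h : p ∉ Q.contractedPrimes R) :
    ∃ s ∉ p, ∀ f : A, (∃ j : ℕ, ∀ a ∈ p ^ j, algebraMap R A a * f ∈ Q) →
      algebraMap R A s * f ∈ Q := by
  obtain ⟨s, hs, hs'⟩ := exists_notMem_forall_smul_eq_zero h
  have key : ∀ a f : A, a • (Ideal.Quotient.mk Q f) = 0 ↔ a * f ∈ Q := fun a f ↦ by
    rw [← Ideal.Quotient.eq_zero_iff_mem, map_mul]
    rfl
  refine ⟨s, hs, fun f ⟨j, hj⟩ ↦ ?_⟩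
  rw [← key]
  exact hs' _ ⟨j, fun a ha ↦ (key _ _).2 (hj a ha)⟩

end Contraction

namespace Ideal

/-- The ideal `⨁ Bⁿ⁺¹tⁿ` of the Rees algebra `⨁ Bⁿtⁿ`; the quotient is the associated graded
ring of `B`. -/
def reesShift {R : Type*} [CommRing R] (B : Ideal R) : Ideal (reesAlgebra B) where
  carrier := {f | ∀ i, (f : Polynomial R).coeff i ∈ B ^ (i + 1)}
  zero_mem' i := by simp
  add_mem' hf hg i := by
    rw [Subalgebra.coe_add, Polynomial.coeff_add]
    exact add_mem (hf i) (hg i)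
  smul_mem' c f hf i := by
    rw [smul_eq_mul, Subalgebra.coe_mul, Polynomial.coeff_mul]
    refine sum_mem _ fun x hx ↦ ?_
    rw [← Finset.HasAntidiagonal.mem_antidiagonal.1 hx, add_assoc, pow_add]
    exact mul_mem_mul (c.2 x.1) (hf x.2)

theorem monomial_mem_reesShift {R : Type*} [CommRing R] {B : Ideal R} {l : ℕ} {x : R}
    (hx : x ∈ B ^ l) :
    (⟨Polynomial.monomial l x, reesAlgebra.monomial_mem.2 hx⟩ : reesAlgebra B) ∈ B.reesShift ↔
      x ∈ B ^ (l + 1) := by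
  refine ⟨fun h ↦ by simpa using h l, fun h i ↦ ?_⟩
  simp only [Polynomial.coeff_monomial]
  split_ifs with hi
  · exact hi ▸ h
  · exact zero_mem _

/-- The contractions to `R` of the associated primes of the associated graded ring of `B`. -/
def gradedPrimes {R : Type*} [CommRing R] (B : Ideal R) : Set (Ideal R) :=
  contractedPrimes R B.reesShift

theorem exists_notMem_forall_pow_mul_mem_pow {R : Type*} [CommRing R] [IsNoetherianRing R]
    {B p : Ideal R} [p.IsPrime] (h : p ∉ B.gradedPrimes) :
    ∃ s ∉ p, ∀ (l : ℕ) (x : R), (∃ j : ℕ, ∀ a ∈ p ^ j, a * x ∈ B ^ l) → s ^ l * x ∈ B ^ l := by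
  obtain ⟨s, hs, hs'⟩ := exists_notMem_forall_mul_mem h
  have key : ∀ (a : R) (l : ℕ) (x : R) (hx : x ∈ B ^ l), algebraMap R (reesAlgebra B) a *
      (⟨Polynomial.monomial l x, reesAlgebra.monomial_mem.2 hx⟩ : reesAlgebra B) ∈ B.reesShift ↔
      a * x ∈ B ^ (l + 1) := by
    intro a l x hx
    rw [← monomial_mem_reesShift (mul_mem_left _ a hx)]
    congr! 1
    refine Subtype.ext ?_
    change Polynomial.C a * Polynomial.monomial l x = _
    rw [Polynomial.C_mul_monomial]
  refine ⟨s, hs, fun l ↦ ?_⟩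
  induction l with
  | zero => intro x _; simp
  | succ l ih =>
    rintro x ⟨j, hj⟩
    have h1 : s ^ l * x ∈ B ^ l := ih x ⟨j, fun a ha ↦ pow_le_pow_right l.le_succ (hj a ha)⟩
    rw [pow_succ' s, mul_assoc, ← key s l _ h1]
    refine hs' _ ⟨j, fun a ha ↦ (key a l _ h1).2 ?_⟩
    rw [mul_left_comm]
    exact mul_mem_left _ _ (hj a ha)

variable {R : Type} [CommRing R] [IsNoetherianRing R]

theorem mem_gradedPrimes_of_eq_colon_intClosure {B p : Ideal R} [hp : p.IsPrime]
    (hann : ∀ (l : ℕ) (d : R), (∀ a ∈ B ^ l, d * a = 0) → IsNilpotent d) {n : ℕ} {c : R}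
    (hc : (p : Set R) = {r | r * c ∈ (B ^ n).intClosure}) : p ∈ B.gradedPrimes := by
  by_contra h
  obtain ⟨s, hs, hs'⟩ := exists_notMem_forall_pow_mul_mem_pow h
  have hmem : ∀ r, r ∈ p ↔ r * c ∈ (B ^ n).intClosure := fun r ↦ by
    rw [← SetLike.mem_coe, hc, Set.mem_ofPred_eq]
  obtain ⟨T, hT⟩ := (isNoetherianRing_iff_ideal_fg R).1 ‹_› (p * span {c})
  obtain ⟨k, hk⟩ := exists_pow_succ_le_mul_pow_of_subset_intClosure (J := B ^ n) T fun x hx ↦ by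
    have hx' : x ∈ p * span {c} := hT ▸ subset_span hx
    obtain ⟨r, hr, rfl⟩ := mem_mul_span_singleton.1 hx'
    exact (hmem r).1 hr
  change span (T : Set R) = _ at hT
  rw [hT] at hk
  set D := B ^ n ⊔ p * span {c}
  have hD : ∀ m, D ^ (k + m) ≤ (B ^ n) ^ m := by
    intro m
    induction m with
    | zero => simp
    | succ m ih =>
      calc D ^ (k + (m + 1)) = D ^ (k + 1) * D ^ m := by rw [← pow_add]; congr 1; omega
        _ ≤ B ^ n * D ^ k * D ^ m := mul_mono_left hk
        _ = B ^ n * D ^ (k + m) := by rw [mul_assoc, pow_add]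
        _ ≤ _ := by rw [pow_succ']; exact mul_mono_right ih
  refine hs (hp.mem_of_pow_mem n ((hmem _).2
    (mem_intClosure_of_pow_mul_mem (k := k) (fun l d hd ↦ ?_) fun m ↦ ?_)))
  · exact hann (n * l) d (by rwa [pow_mul])
  · have h1 := hs' (n * m) (c ^ (k + m)) ⟨k + m, fun a ha ↦ by
      rw [pow_mul]
      refine hD m (pow_right_mono (le_sup_right (a := B ^ n)) _ ?_)
      rw [mul_pow]
      exact mul_mem_mul ha (pow_mem_pow (mem_span_singleton_self c) _)⟩
    rw [pow_mul B] at h1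
    have h2 : (s ^ n * c) ^ (k + m) = s ^ (n * k) * (s ^ (n * m) * c ^ (k + m)) := by ring
    rw [h2]
    exact mul_mem_left _ _ h1

theorem isNilpotent_of_forall_mul_eq_zero {R : Type*} [CommRing R] {B : Ideal R}
    (hB : ∀ q ∈ minimalPrimes R, ¬ B ≤ q) (l : ℕ) (d : R) (hd : ∀ a ∈ B ^ l, d * a = 0) :
    IsNilpotent d := by
  rw [← mem_nilradical, nilradical, ← sInf_minimalPrimes, Submodule.mem_sInf]
  intro q hq
  have hqp : Ideal.IsPrime q := hq.1.1
  by_contra hdq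
  refine hB q hq (hqp.le_of_pow_le (n := l) fun a ha ↦ ?_)
  exact (hqp.mem_or_mem (hd a ha ▸ q.zero_mem)).resolve_left hdq

/-- If the annihilators of the powers of `B` are nilpotent then `((Bⁿ⁺¹)ₐ : B) = (Bⁿ)ₐ`. -/
theorem mem_intClosure_pow_of_forall_mul_mem {B : Ideal R}
    (hann : ∀ (l : ℕ) (d : R), (∀ a ∈ B ^ l, d * a = 0) → IsNilpotent d) {n : ℕ} (S : Finset R)
    (hS : span (S : Set R) = B) {y : R} (hy : ∀ b ∈ S, b * y ∈ (B ^ (n + 1)).intClosure) :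
    y ∈ (B ^ n).intClosure := by
  classical
  obtain ⟨k, hk⟩ := exists_pow_succ_le_mul_pow_of_subset_intClosure (S.image (· * y))
    fun c hc ↦ by
      obtain ⟨b, hb, rfl⟩ := Finset.mem_image.1 hc
      exact hy b hb
  set D := B ^ (n + 1) ⊔ span ((S.image (· * y) : Finset R) : Set R)
  have h1 : B ≤ Submodule.comap (LinearMap.mulRight R y) D := by
    rw [← hS, span_le]
    exact fun b hb ↦ le_sup_right (a := B ^ (n + 1))
      (subset_span (Finset.mem_coe.2 (Finset.mem_image_of_mem _ hb)))
  have h2 : span {y} * B ≤ D := by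
    rw [span_singleton_mul_le_iff]
    intro b hb
    rw [mul_comm]
    exact h1 hb
  refine mem_intClosure_of_mul_le (M := B * D ^ k) (IsNoetherian.noetherian _) (fun a ha ↦ ?_)
    fun d hd ↦ hann ((n + 1) * k + 1) d fun a ha ↦ hd a ?_
  · have h3 : span {y} * (B * D ^ k) ≤ B ^ n * (B * D ^ k) := by
      calc _ = span {y} * B * D ^ k := (mul_assoc _ _ _).symm
        _ ≤ D ^ (k + 1) := by rw [pow_succ']; exact mul_mono_left h2
        _ ≤ B ^ (n + 1) * D ^ k := hk
        _ = _ := by rw [pow_succ, mul_assoc]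
    exact h3 (mul_mem_mul (mem_span_singleton_self y) ha)
  · rw [pow_succ', pow_mul] at ha
    exact mul_mono_right (pow_right_mono le_sup_left k) ha

theorem mul_mem_relIntClosure_pow_succ {R : Type} [CommRing R] {I : Ideal R} {N : Type}
    [AddCommGroup N] [Module R N] {n : ℕ} {b x : R} (hb : b ∈ I)
    (hx : x ∈ (I ^ n).relIntClosure N) : b * x ∈ (I ^ (n + 1)).relIntClosure N := by
  obtain ⟨m, hm, h⟩ := hx
  refine ⟨m, hm, fun y ↦ ?_⟩
  have key : (⨆ i ∈ Finset.Icc 1 m, x ^ (m - i) • ((I ^ n) ^ i • (⊤ : Submodule R N))) ≤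
      Submodule.comap (LinearMap.lsmul R N (b ^ m)) (⨆ i ∈ Finset.Icc 1 m,
        (b * x) ^ (m - i) • ((I ^ (n + 1)) ^ i • (⊤ : Submodule R N))) := by
    refine iSup₂_le fun i hi ↦ ?_
    rintro z hz
    obtain ⟨w, hw, rfl⟩ := (Submodule.mem_smul_pointwise_iff_exists _ _ _).1 hz
    refine Submodule.mem_iSup_of_mem i (Submodule.mem_iSup_of_mem hi
      ((Submodule.mem_smul_pointwise_iff_exists _ _ _).2 ⟨b ^ i • w, ?_, ?_⟩))
    · rw [pow_succ', mul_pow, Submodule.mul_smul]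
      exact Submodule.smul_mem_smul (pow_mem_pow hb i) hw
    · rw [LinearMap.lsmul_apply, ← mul_smul, ← mul_smul, mul_pow, mul_right_comm, ← pow_add,
        Nat.sub_add_cancel (Finset.mem_Icc.1 hi).2]
  rw [mul_pow, mul_smul]
  exact key (h y)

theorem mem_relIntClosure_of_mem_annihilator {R : Type} [CommRing R] (I : Ideal R) {N : Type}
    [AddCommGroup N] [Module R N] {x : R} (hx : x ∈ Module.annihilator R N) :
    x ∈ I.relIntClosure N :=
  ⟨1, one_pos, fun m ↦ by
    rw [pow_one, Module.mem_annihilator.1 hx m]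
    exact zero_mem _⟩

end Ideal

theorem Monotone.exists_forall_eq_of_subset_finite {α : Type*} {f : ℕ → Set α} (hf : Monotone f)
    {s : Set α} (hs : s.Finite) (h : ∀ n, f n ⊆ s) : ∃ n, ∀ m, n ≤ m → f m = f n := by
  have : Finite (Set.powerset s) := hs.finite_subsets
  obtain ⟨n, hn⟩ := WellFoundedGT.monotone_chain_condition
    (⟨fun n ↦ (⟨f n, h n⟩ : Set.powerset s), fun _ _ hab ↦ hf hab⟩ : ℕ →o Set.powerset s)
  exact ⟨n, fun m hm ↦ (congrArg Subtype.val (hn m hm)).symm⟩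

/-- If a finite set `S` generates `B`, the powers of `B` have nilpotent annihilators and
`S • X ⊆ X'`, then `Ass (X/(Bⁿ)ₐ) ⊆ Ass (X'/(Bⁿ⁺¹)ₐ)`. -/
theorem assQuot₂_intClosure_pow_subset_succ {R : Type} [CommRing R] [IsNoetherianRing R]
    {B : Ideal R} (hann : ∀ (l : ℕ) (d : R), (∀ a ∈ B ^ l, d * a = 0) → IsNilpotent d)
    {S : Finset R} (hS : Ideal.span (S : Set R) = B) {n : ℕ} {X X' : Set R}
    (hX : ∀ b ∈ S, ∀ x ∈ X, b * x ∈ X') :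
    assQuot₂ X ((B ^ n).intClosure) ⊆ assQuot₂ X' ((B ^ (n + 1)).intClosure) := by
  rintro p ⟨hp, x, hx, hpx⟩
  have hmem : ∀ r, r ∈ p ↔ r * x ∈ (B ^ n).intClosure := fun r ↦ by
    rw [← SetLike.mem_coe, hpx, Set.mem_ofPred_eq]
  refine ⟨hp, ?_⟩
  by_contra! hne
  have hsub : ∀ b ∈ S, ∃ r ∉ p, r * (b * x) ∈ (B ^ (n + 1)).intClosure := by
    intro b hb
    by_contra! hr
    refine hne (b * x) (hX b hb x hx) (Set.Subset.antisymm (fun r hrp ↦ ?_) fun r hrb ↦ ?_)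
    · rw [Set.mem_ofPred_eq, mul_left_comm]
      refine Ideal.mul_mem_intClosure (fun a ha ↦ ?_) ((hmem r).1 hrp)
      rw [pow_succ']
      exact Ideal.mul_mem_mul (hS ▸ Ideal.subset_span hb) ha
    · by_contra hrp
      exact hr r hrp hrb
  choose! r hrp hr using hsub
  have hprod : ∏ b ∈ S, r b ∉ p := fun h ↦ by
    obtain ⟨b, hb, hb'⟩ := hp.prod_mem_iff.1 h
    exact hrp b hb hb'
  refine hprod ((hmem _).2 (Ideal.mem_intClosure_pow_of_forall_mul_mem hann S hS fun b hb ↦ ?_))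
  obtain ⟨c, hc⟩ := Finset.dvd_prod_of_mem r hb
  have e : b * ((∏ b ∈ S, r b) * x) = c * (r b * (b * x)) := by rw [hc]; ring
  rw [e]
  exact Ideal.mul_mem_intClosure (fun a ha ↦ Ideal.mul_mem_left _ _ ha) (hr b hb)

/-- Over a Noetherian ring, the sequence `Ass_R (I^n)^{(N)}_a/((I + Ann_R N)^n)_a`, `n ≥ 1`,
is increasing and ultimately constant. -/
theorem assQuot₂_relIntClosure_intClosure_add_annihilator_pow {R : Type} [CommRing R]
    [IsNoetherianRing R] (N : Type) [AddCommGroup N] [Module R N] [Module.Finite R N]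
    (I : Ideal R) (hI : ∀ p ∈ (Module.annihilator R N).minimalPrimes, ¬ I ≤ p) :
    (∀ n : ℕ, 1 ≤ n →
      assQuot₂ ((I ^ n).relIntClosure N) (((I + Module.annihilator R N) ^ n).intClosure) ⊆
        assQuot₂ ((I ^ (n + 1)).relIntClosure N)
          (((I + Module.annihilator R N) ^ (n + 1)).intClosure)) ∧
    ∃ n₀ : ℕ, 1 ≤ n₀ ∧ ∀ n : ℕ, n₀ ≤ n →
      assQuot₂ ((I ^ n).relIntClosure N) (((I + Module.annihilator R N) ^ n).intClosure) =
        assQuot₂ ((I ^ n₀).relIntClosure N) (((I + Module.annihilator R N) ^ n₀).intClosure) := by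
  classical
  set K := Module.annihilator R N
  have hann := Ideal.isNilpotent_of_forall_mul_eq_zero (B := I + K) fun q hq hle ↦ by
    have hIK := sup_le_iff.1 hle
    exact hI q ⟨⟨hq.1.1, hIK.2⟩, fun q' hq' h ↦ hq.2 ⟨hq'.1, bot_le⟩ h⟩ hIK.1
  obtain ⟨S, hS⟩ := (isNoetherianRing_iff_ideal_fg R).1 ‹_› I
  obtain ⟨T, hT⟩ := (isNoetherianRing_iff_ideal_fg R).1 ‹_› K
  have hST : Ideal.span ((S ∪ T : Finset R) : Set R) = I + K := by
    rw [Finset.coe_union, Ideal.span_union, hS, hT]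
    rfl
  have hmono : ∀ n : ℕ,
      assQuot₂ ((I ^ n).relIntClosure N) (((I + K) ^ n).intClosure) ⊆
        assQuot₂ ((I ^ (n + 1)).relIntClosure N) (((I + K) ^ (n + 1)).intClosure) := by
    refine fun n ↦ assQuot₂_intClosure_pow_subset_succ hann hST fun b hb x hx ↦ ?_
    obtain hb | hb := Finset.mem_union.1 hb
    · exact Ideal.mul_mem_relIntClosure_pow_succ (hS ▸ Submodule.subset_span hb) hx
    · have hbK : b ∈ K := hT ▸ Submodule.subset_span hb
      exact Ideal.mem_relIntClosure_of_mem_annihilator _ (K.mul_mem_right x hbK)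
  refine ⟨fun n _ ↦ hmono n, ?_⟩
  obtain ⟨n₀, h⟩ := (monotone_nat_of_le_succ hmono).exists_forall_eq_of_subset_finite
    (Ideal.finite_contractedPrimes R (I + K).reesShift) fun n p hp ↦ by
      obtain ⟨hp, c, -, hc⟩ := hp
      exact Ideal.mem_gradedPrimes_of_eq_colon_intClosure hann hc
  exact ⟨n₀ + 1, by omega, fun n hn ↦ (h n (by omega)).trans (h (n₀ + 1) (by omega)).symm⟩
end

section
/- Let R be a Noetherian commutative ring, I an ideal of R, and N a finitely generated R-module. Then A*_a(I + Ann_R N) ∖ C*_a(I, N) ⊆ A*_a(I, N). Explicitly: there exists n_0 ≥ 1 such that for all n ≥ n_0 the sets Ass_R R/((I + Ann_R N)^n)_a, Ass_R (I^n)^{(N)}_a/((I + Ann_R N)^n)_a, and Ass_R R/(I^n)^{(N)}_a are independent of n, and every prime belonging to the first set but not the second belongs to the third. -/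
open Pointwise

namespace Ideal

open Polynomial

variable {R : Type} [CommRing R]

/-- The ideal `H` is a reduction of `H ⊔ L`. -/
def IsReductionOfSup (H L : Ideal R) : Prop :=
  ∃ k : ℕ, (H ⊔ L) ^ (k + 1) ≤ H * (H ⊔ L) ^ k

theorem sup_pow_le_of_forall_s7 {A B X : Ideal R} {m : ℕ}
    (h : ∀ i j, i + j = m → A ^ i * B ^ j ≤ X) : (A ⊔ B) ^ m ≤ X := by
  have key : ∀ n : ℕ, ∀ Y : Ideal R, (∀ i j, i + j = n → A ^ i * B ^ j ≤ Y) → (A ⊔ B) ^ n ≤ Y := by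
    intro n
    induction n with
    | zero => intro Y hY; simpa using hY 0 0 rfl
    | succ n ih =>
      intro Y hY
      have hs : (A ⊔ B) ^ n ≤ Y.colon ((A ⊔ B : Ideal R) : Set R) := by
        apply ih
        intro i j hij x hx
        rw [Submodule.mem_colon]
        intro z hz
        obtain ⟨a, ha, b, hb, rfl⟩ := Submodule.mem_sup.mp hz
        rw [smul_add]
        refine Y.add_mem (hY (i + 1) j (by omega) ?_) (hY i (j + 1) (by omega) ?_)
        · have := Ideal.mul_mem_mul hx ha
          rwa [mul_right_comm, ← pow_succ] at this
        · have := Ideal.mul_mem_mul hx hb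
          rwa [mul_assoc, ← pow_succ] at this
      rw [pow_succ, Ideal.mul_le]
      intro r hr s hs'
      exact (Submodule.mem_colon.mp (hs hr)) s hs'
  exact key m X h

theorem IsReductionOfSup.sup {H L₁ L₂ : Ideal R} (h₁ : H.IsReductionOfSup L₁)
    (h₂ : H.IsReductionOfSup L₂) : H.IsReductionOfSup (L₁ ⊔ L₂) := by
  obtain ⟨k₁, h₁⟩ := h₁
  obtain ⟨k₂, h₂⟩ := h₂
  have e : H ⊔ (L₁ ⊔ L₂) = (H ⊔ L₁) ⊔ (H ⊔ L₂) := by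
    rw [sup_sup_sup_comm, sup_idem]
  refine ⟨k₁ + k₂, ?_⟩
  rw [e]
  set A := H ⊔ L₁
  set B := H ⊔ L₂
  have hA : A ≤ A ⊔ B := le_sup_left
  have hB : B ≤ A ⊔ B := le_sup_right
  refine sup_pow_le_of_forall_s7 fun i j hij => ?_
  rcases Nat.lt_or_ge k₁ i with hi | hi
  · obtain ⟨t, rfl⟩ := Nat.exists_eq_add_of_le hi
    calc A ^ (k₁ + 1 + t) * B ^ j = A ^ (k₁ + 1) * (A ^ t * B ^ j) := by rw [pow_add, mul_assoc]
      _ ≤ (H * A ^ k₁) * (A ^ t * B ^ j) := Ideal.mul_mono_left h₁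
      _ ≤ (H * (A ⊔ B) ^ k₁) * ((A ⊔ B) ^ t * (A ⊔ B) ^ j) := by gcongr
      _ = H * (A ⊔ B) ^ (k₁ + k₂) := by
        rw [mul_assoc, ← pow_add, ← pow_add]; congr 2; omega
  · obtain ⟨t, rfl⟩ := Nat.exists_eq_add_of_le (show k₂ + 1 ≤ j by omega)
    calc A ^ i * B ^ (k₂ + 1 + t) = B ^ (k₂ + 1) * (A ^ i * B ^ t) := by rw [pow_add]; ring
      _ ≤ (H * B ^ k₂) * (A ^ i * B ^ t) := Ideal.mul_mono_left h₂
      _ ≤ (H * (A ⊔ B) ^ k₂) * ((A ⊔ B) ^ i * (A ⊔ B) ^ t) := by gcongr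
      _ = H * (A ⊔ B) ^ (k₁ + k₂) := by
        rw [mul_assoc, ← pow_add, ← pow_add]; congr 2; omega

theorem IsReductionOfSup.bot (H : Ideal R) : H.IsReductionOfSup ⊥ :=
  ⟨0, by simp⟩

theorem IsReductionOfSup.mono {H L L' : Ideal R} (h : H.IsReductionOfSup L) (hL : L' ≤ L) :
    ∃ c : ℕ, ∀ m, L' ^ m ≤ H ^ (m - c) := by
  obtain ⟨k, hk⟩ := h
  refine ⟨k, fun m => ?_⟩
  have key : ∀ t, (H ⊔ L) ^ (k + t) ≤ H ^ t := by
    have : ∀ t, (H ⊔ L) ^ (k + t) ≤ H ^ t * (H ⊔ L) ^ k := by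
      intro t
      induction t with
      | zero => simp
      | succ t ih =>
        calc (H ⊔ L) ^ (k + (t + 1)) = (H ⊔ L) ^ (k + t) * (H ⊔ L) := by rw [← pow_succ]; rfl
          _ ≤ (H ^ t * (H ⊔ L) ^ k) * (H ⊔ L) := Ideal.mul_mono_left ih
          _ = H ^ t * (H ⊔ L) ^ (k + 1) := by rw [mul_assoc, ← pow_succ]
          _ ≤ H ^ t * (H * (H ⊔ L) ^ k) := Ideal.mul_mono_right hk
          _ = H ^ (t + 1) * (H ⊔ L) ^ k := by rw [← mul_assoc, ← pow_succ]
    exact fun t => (this t).trans Ideal.mul_le_left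
  have h1 : L' ^ m ≤ (H ⊔ L) ^ m := Ideal.pow_right_mono (hL.trans le_sup_right) m
  rcases Nat.lt_or_ge m k with hm | hm
  · rw [Nat.sub_eq_zero_of_le hm.le]; simp
  · obtain ⟨t, rfl⟩ := Nat.exists_eq_add_of_le hm
    simpa using h1.trans (key t)

/-- If `x ^ n + ⋯` is a nilpotent value of a monic polynomial with coefficients in the powers of
`H`, then `H` is a reduction of `H + (x)`. -/
theorem isReductionOfSup_span_singleton_of_isNilpotent {H : Ideal R} {x : R} {f : R[X]}
    (hf : f.Monic) (hc : ∀ i, f.coeff i ∈ H ^ (f.natDegree - i)) (hx : IsNilpotent (f.eval x)) :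
    H.IsReductionOfSup (span {x}) := by
  obtain ⟨e, he⟩ := hx
  set d := f.natDegree with hd
  set W := H ⊔ span {x} with hW
  have hxW : x ∈ W := le_sup_right (a := H) (mem_span_singleton_self x)
  have hHW : H ≤ W := le_sup_left
  have hlow : ∀ i < d, f.coeff i * x ^ i ∈ H * W ^ (d - 1) := by
    intro i hi
    have h1 : f.coeff i * x ^ i ∈ H ^ (d - i) * W ^ i :=
      mul_mem_mul (hc i) (pow_mem_pow hxW i)
    have h2 : H ^ (d - i) * W ^ i ≤ H * W ^ (d - 1) := by
      obtain ⟨t, ht⟩ := Nat.exists_eq_add_of_lt hi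
      have : d - i = t + 1 := by omega
      rw [this, pow_succ']
      calc H * H ^ t * W ^ i ≤ H * W ^ t * W ^ i := by gcongr
        _ = H * W ^ (d - 1) := by rw [mul_assoc, ← pow_add]; congr 2; omega
    exact h2 h1
  have heval : f.eval x = x ^ d + ∑ i ∈ Finset.range d, f.coeff i * x ^ i := by
    rw [eval_eq_sum_range, Finset.sum_range_succ, add_comm, ← hd]
    congr 1
    rw [show f.coeff d = 1 from hf]; simp
  have hsum : ∑ i ∈ Finset.range d, f.coeff i * x ^ i ∈ H * W ^ (d - 1) :=
    Ideal.sum_mem _ fun i hi => hlow i (Finset.mem_range.mp hi)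
  rcases Nat.eq_zero_or_pos d with h0 | hpos
  · have h1 : f.eval x = 1 := by rw [heval, h0]; simp
    rw [h1, one_pow] at he
    have : ∀ A : Ideal R, ∀ y ∈ A, y = 0 := fun A y _ => by rw [← mul_one y, he, mul_zero]
    refine ⟨0, fun y hy => ?_⟩
    rw [this _ y hy]; exact zero_mem _
  have hHWd : H * W ^ (d - 1) ≤ W ^ d := by
    calc H * W ^ (d - 1) ≤ W * W ^ (d - 1) := by gcongr
      _ = W ^ d := by rw [← pow_succ']; congr 1; omega
  set ν := f.eval x with hν
  have hνW : ν ∈ W ^ d := by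
    rw [heval]
    exact add_mem (pow_mem_pow hxW d) (hHWd hsum)
  have hWd : W ^ d ≤ H * W ^ (d - 1) ⊔ span {ν} := by
    refine sup_pow_le_of_forall_s7 fun i j hij => ?_
    rcases i with _ | i
    · have hj : j = d := by omega
      rw [hj, pow_zero, one_mul, span_singleton_pow, span_singleton_le_iff_mem]
      have : x ^ d = -(∑ i ∈ Finset.range d, f.coeff i * x ^ i) + ν := by rw [heval]; ring
      rw [this]
      exact Submodule.add_mem_sup (neg_mem hsum) (mem_span_singleton_self ν)
    · refine le_trans ?_ le_sup_left
      calc H ^ (i + 1) * span {x} ^ j ≤ H * W ^ i * W ^ j := by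
            rw [pow_succ']
            gcongr
            exact le_sup_right
        _ = H * W ^ (d - 1) := by rw [mul_assoc, ← pow_add]; congr 2; omega
  have he' : ν ^ (e + 1) = 0 := by rw [pow_succ, he, zero_mul]
  refine ⟨d * (e + 1) - 1, ?_⟩
  have h1 : d * (e + 1) - 1 + 1 = d * (e + 1) :=
    Nat.sub_add_cancel (Nat.mul_pos hpos (Nat.succ_pos e))
  rw [h1, pow_mul]
  refine (Ideal.pow_right_mono hWd (e + 1)).trans (sup_pow_le_of_forall_s7 fun i j hij => ?_)
  rcases i with _ | i
  · have hj : j = e + 1 := by omega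
    rw [hj, pow_zero, one_mul, span_singleton_pow, he']
    simp
  · calc (H * W ^ (d - 1)) ^ (i + 1) * span {ν} ^ j
        ≤ (H * W ^ (d - 1)) * (W ^ d) ^ i * (W ^ d) ^ j := by
          rw [pow_succ']
          gcongr
          rwa [span_singleton_le_iff_mem]
      _ = H * W ^ (d * (e + 1) - 1) := by
          rw [← pow_mul, ← pow_mul, mul_assoc, mul_assoc, ← pow_add, ← pow_add]
          congr 2
          have : e = i + j := by omega
          subst this
          rw [← Nat.mul_add, Nat.mul_add d (i + j) 1, mul_one]
          omega

theorem isReductionOfSup_span_singleton {H : Ideal R} {x : R} (hx : x ∈ H.intClosure) :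
    H.IsReductionOfSup (span {x}) := by
  rcases subsingleton_or_nontrivial R with _ | _
  · exact ⟨0, fun y _ => by rw [Subsingleton.elim y 0]; exact zero_mem _⟩
  obtain ⟨n, hn, r, hr, h⟩ := hx
  let g : R[X] := ∑ i ∈ Finset.Icc 1 n, C (r i) * X ^ (n - i)
  have hg : g.degree < n := by
    refine (degree_sum_le _ _).trans_lt ?_
    rw [Finset.sup_lt_iff (by exact_mod_cast WithBot.bot_lt_coe n)]
    intro i hi
    refine (degree_C_mul_X_pow_le _ _).trans_lt ?_
    rw [Finset.mem_Icc] at hi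
    exact_mod_cast (by omega : n - i < n)
  have hdeg : (X ^ n + g).natDegree = n := by
    refine natDegree_eq_of_degree_eq_some ?_
    rw [degree_add_eq_left_of_degree_lt (by simpa using hg), degree_X_pow]
  refine isReductionOfSup_span_singleton_of_isNilpotent (f := X ^ n + g)
    (monic_X_pow_add hg) ?_ ?_
  · intro k
    rw [hdeg, coeff_add, coeff_X_pow]
    refine add_mem ?_ ?_
    · split_ifs with hk
      · simp [hk]
      · exact zero_mem _
    · simp only [g, finsetSum_coeff, coeff_C_mul_X_pow]
      refine Ideal.sum_mem _ fun i hi => ?_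
      split_ifs with hk
      · rw [Finset.mem_Icc] at hi
        rw [show n - k = i by omega]
        exact hr i (Finset.mem_Icc.mpr hi)
      · exact zero_mem _
  · have : (X ^ n + g).eval x = 0 := by
      rw [← h]
      simp [g, eval_finsetSum]
    rw [this]
    exact IsNilpotent.zero

theorem isReductionOfSup_of_subset_intClosure [IsNoetherianRing R] {H L : Ideal R}
    (hL : (L : Set R) ⊆ H.intClosure) : H.IsReductionOfSup L := by
  classical
  obtain ⟨s, rfl⟩ := IsNoetherian.noetherian L
  induction s using Finset.induction_on with
  | empty => simpa using IsReductionOfSup.bot H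
  | insert a s _ ih =>
    rw [Finset.coe_insert, Submodule.span_insert] at hL ⊢
    refine IsReductionOfSup.sup (isReductionOfSup_span_singleton (hL ?_)) (ih fun y hy => hL ?_)
    · exact Submodule.mem_sup_left (Submodule.mem_span_singleton_self a)
    · exact Submodule.mem_sup_right hy

theorem mem_intClosure_of_pow_eq_sum {H : Ideal R} {y : R} {n : ℕ} (hn : 0 < n) (b : ℕ → R)
    (hb : ∀ i < n, b i ∈ H ^ (n - i)) (h : y ^ n = ∑ i ∈ Finset.range n, b i * y ^ i) :
    y ∈ H.intClosure := by
  refine ⟨n, hn, fun i => -b (n - i), fun i hi => ?_, ?_⟩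
  · rw [Finset.mem_Icc] at hi
    have := hb (n - i) (by omega)
    rw [Nat.sub_sub_self hi.2] at this
    exact neg_mem this
  · have : ∑ i ∈ Finset.Icc 1 n, -b (n - i) * y ^ (n - i) =
        -∑ i ∈ Finset.range n, b i * y ^ i := by
      rw [← Finset.sum_neg_distrib]
      refine Finset.sum_nbij' (fun i => n - i) (fun i => n - i) ?_ ?_ ?_ ?_ ?_
      · intro i hi
        simp only [Finset.mem_Icc, Finset.mem_range] at *
        omega
      · intro i hi
        simp only [Finset.mem_Icc, Finset.mem_range] at *
        omega
      · intro i hi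
        simp only [Finset.mem_Icc] at *
        omega
      · intro i hi
        simp only [Finset.mem_range] at *
        omega
      · intro i _
        ring
    rw [this, h]
    ring

/-- If, up to multipliers in a submonoid `S`, the powers `x ^ m` lie in `H ^ (m - c)`, then some
multiple of `x` by an element of `S` is integral over `H`. -/
theorem exists_mul_mem_intClosure [IsNoetherianRing R] {H : Ideal R} (S : Submonoid R) {x : R}
    (c : ℕ) (hx : ∀ m, ∃ s ∈ S, s * x ^ m ∈ H ^ (m - c)) : ∃ s ∈ S, s * x ∈ H.intClosure := by
  classical
  choose s hsS hs using hx
  have hmem : ∀ m, s (m + c) * x ^ (m + c) ∈ H ^ m := fun m => by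
    simpa using hs (m + c)
  let f : ℕ → reesAlgebra H := fun m =>
    ⟨monomial m (s (m + c) * x ^ (m + c)), reesAlgebra.monomial_mem.mpr (hmem m)⟩
  let T : ℕ →o Ideal (reesAlgebra H) :=
    ⟨fun M => span (f '' ((Finset.range M : Finset ℕ) : Set ℕ)), fun a b hab =>
      span_mono (Set.image_mono (by exact_mod_cast Finset.range_mono hab))⟩
  obtain ⟨M, hM⟩ := monotone_stabilizes_iff_noetherian.mpr
    (inferInstance : IsNoetherianRing (reesAlgebra H)) T
  have hfM : f M ∈ T M := by
    rw [hM (M + 1) (Nat.le_succ M)]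
    exact subset_span ⟨M, by simp, rfl⟩
  obtain ⟨a, ha⟩ : ∃ a : ℕ → reesAlgebra H, ∑ i ∈ Finset.range M, a i * f i = f M := by
    have := (Submodule.mem_span_image_finset_iff_exists_fun (reesAlgebra H)).mp hfM
    obtain ⟨a, ha⟩ := this
    refine ⟨fun i => if h : i ∈ Finset.range M then a ⟨i, h⟩ else 0, ?_⟩
    rw [← ha, ← Finset.sum_coe_sort]
    refine Finset.sum_congr rfl fun i _ => ?_
    dsimp only
    rw [dif_pos i.2, smul_eq_mul]
  have hco : s (M + c) * x ^ (M + c) =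
      ∑ i ∈ Finset.range M, (a i : R[X]).coeff (M - i) * (s (i + c) * x ^ (i + c)) := by
    have h1 := congrArg (fun g : reesAlgebra H => (g : R[X]).coeff M) ha
    simp only [AddSubmonoidClass.coe_finsetSum, MulMemClass.coe_mul, finsetSum_coeff, f,
      coeff_monomial, if_true] at h1
    rw [← h1]
    refine Finset.sum_congr rfl fun i hi => ?_
    have hi' : M - i + i = M := Nat.sub_add_cancel (Finset.mem_range.mp hi).le
    have h2 := coeff_mul_monomial (a i : R[X]) i (M - i) (s (i + c) * x ^ (i + c))
    rwa [hi'] at h2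
  refine ⟨s (M + c), hsS _, ?_⟩
  set t := s (M + c) with ht
  refine mem_intClosure_of_pow_eq_sum (n := M + (c + 1)) (by omega)
    (fun i => if c + 1 ≤ i then (a (i - (c + 1)) : R[X]).coeff (M - (i - (c + 1))) *
      (s (i - (c + 1) + c) * t ^ (M + c - i)) else 0) ?_ ?_
  · intro i hi
    split_ifs with h
    · have h2 := (mem_reesAlgebra_iff H _).mp (a (i - (c + 1))).2 (M - (i - (c + 1)))
      rw [show M - (i - (c + 1)) = M + (c + 1) - i by omega] at h2 ⊢
      exact Ideal.mul_mem_right _ _ h2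
    · exact zero_mem _
  · rw [add_comm M (c + 1), Finset.sum_range_add, Finset.sum_eq_zero, zero_add]
    · calc (t * x) ^ (c + 1 + M) = t ^ (M + c) * x * (t * x ^ (M + c)) := by
            rw [show c + 1 + M = M + c + 1 by omega]; ring
        _ = _ := by
            rw [hco, Finset.mul_sum]
            refine Finset.sum_congr rfl fun i hi => ?_
            rw [Finset.mem_range] at hi
            rw [if_pos (by omega), Nat.add_sub_cancel_left]
            obtain ⟨q, rfl⟩ := Nat.exists_eq_add_of_lt hi
            rw [show i + q + 1 + c - (c + 1 + i) = q by omega]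
            ring
    · intro i hi
      rw [Finset.mem_range] at hi
      rw [if_neg (by omega), zero_mul]

theorem mem_intClosure_iff_s7 [IsNoetherianRing R] {H : Ideal R} {x : R} :
    x ∈ H.intClosure ↔ ∃ c : ℕ, ∀ m, x ^ m ∈ H ^ (m - c) := by
  constructor
  · intro hx
    obtain ⟨c, hc⟩ := (isReductionOfSup_span_singleton hx).mono le_rfl
    exact ⟨c, fun m => hc m (pow_mem_pow (mem_span_singleton_self x) m)⟩
  · rintro ⟨c, hc⟩
    obtain ⟨s, hs, h⟩ := exists_mul_mem_intClosure (⊥ : Submonoid R) (H := H) (x := x) c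
      fun m => ⟨1, one_mem _, by simpa using hc m⟩
    rw [Submonoid.mem_bot] at hs
    simpa [hs] using h

theorem mem_intClosure_of_monic [IsNoetherianRing R] {H : Ideal R} {x : R} {f : R[X]}
    (hf : f.Monic) (hc : ∀ i, f.coeff i ∈ H ^ (f.natDegree - i)) (hx : IsNilpotent (f.eval x)) :
    x ∈ H.intClosure := by
  obtain ⟨c, hc⟩ := (isReductionOfSup_span_singleton_of_isNilpotent hf hc hx).mono le_rfl
  exact mem_intClosure_iff_s7.mpr ⟨c, fun m => hc m (pow_mem_pow (mem_span_singleton_self x) m)⟩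

/-- The integral closure of an ideal in a Noetherian ring, as an ideal. -/
def intClosureIdeal [IsNoetherianRing R] (H : Ideal R) : Ideal R where
  carrier := H.intClosure
  zero_mem' := mem_intClosure_iff_s7.mpr ⟨1, fun m => by rcases m with _ | m <;> simp⟩
  add_mem' := by
    intro x y hx hy
    obtain ⟨c, hc⟩ := ((isReductionOfSup_span_singleton hx).sup
      (isReductionOfSup_span_singleton hy)).mono le_rfl
    exact mem_intClosure_iff_s7.mpr ⟨c, fun m => hc m (pow_mem_pow (Submodule.add_mem_sup
      (mem_span_singleton_self x) (mem_span_singleton_self y)) m)⟩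
  smul_mem' := by
    intro z x hx
    obtain ⟨c, hc⟩ := mem_intClosure_iff_s7.mp hx
    exact mem_intClosure_iff_s7.mpr ⟨c, fun m => by
      rw [smul_eq_mul, mul_pow]; exact mul_mem_left _ _ (hc m)⟩

theorem mem_intClosureIdeal_of_isNilpotent [IsNoetherianRing R] (H : Ideal R) {x : R}
    (hx : IsNilpotent x) : x ∈ H.intClosureIdeal := by
  obtain ⟨e, he⟩ := hx
  refine mem_intClosure_iff_s7.mpr ⟨e, fun m => ?_⟩
  rcases Nat.lt_or_ge m e with hm | hm
  · simp [Nat.sub_eq_zero_of_le hm.le]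
  · rw [pow_eq_zero_of_le hm he]; exact zero_mem _

theorem mul_mem_intClosureIdeal_pow_succ [IsNoetherianRing R] {J : Ideal R} {n : ℕ} {x j : R}
    (hj : j ∈ J) (hx : x ∈ (J ^ n).intClosureIdeal) : x * j ∈ (J ^ (n + 1)).intClosureIdeal := by
  obtain ⟨c, hc⟩ := mem_intClosure_iff_s7.mp hx
  refine mem_intClosure_iff_s7.mpr ⟨c, fun m => ?_⟩
  have h := mul_mem_mul (hc m) (Ideal.pow_le_pow_right (Nat.sub_le m c) (pow_mem_pow hj m))
  rwa [← mul_pow, ← mul_pow, ← pow_succ] at h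

theorem map_mem_intClosureIdeal [IsNoetherianRing R] {R' : Type} [CommRing R']
    [IsNoetherianRing R'] (φ : R →+* R') {H : Ideal R} {x : R} (hx : x ∈ H.intClosureIdeal) :
    φ x ∈ (H.map φ).intClosureIdeal := by
  obtain ⟨c, hc⟩ := mem_intClosure_iff_s7.mp hx
  refine mem_intClosure_iff_s7.mpr ⟨c, fun m => ?_⟩
  rw [← map_pow, ← Ideal.map_pow]
  exact mem_map_of_mem φ (hc m)

theorem finite_setOf_isPrime_mem_iff_map_mul_mem {S : Type} [CommRing S] [IsNoetherianRing S]
    (φ : R →+* S) (T : Ideal S) :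
    {p : Ideal R | p.IsPrime ∧ ∃ y : S, ∀ r, r ∈ p ↔ φ r * y ∈ T}.Finite := by
  classical
  obtain ⟨t, ht, hprim⟩ := Submodule.isLasker S S T
  refine (t.finite_toSet.image fun q : Ideal S => comap φ q.radical).subset ?_
  rintro p ⟨hp, y, hy⟩
  have hinf : t.inf (fun q : Ideal S => comap φ (q.colon {y})) = p := by
    ext r
    rw [hy, ← ht, Submodule.mem_finsetInf, Submodule.mem_finsetInf]
    simp [Submodule.mem_colon_singleton]
  obtain ⟨q, hq, hqp⟩ := eq_inf_of_isPrime_inf (hinf ▸ hp)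
  rw [hinf] at hqp
  have hmem : ∀ r, r ∈ p ↔ φ r * y ∈ q := by
    intro r
    rw [← hqp, mem_comap, Submodule.mem_colon_singleton, smul_eq_mul]
  have hyq : y ∉ q := fun h => hp.ne_top ((eq_top_iff_one p).mpr ((hmem 1).mpr (by simpa using h)))
  refine ⟨q, hq, ?_⟩
  ext r
  rw [mem_comap]
  constructor
  · rintro ⟨k, hk⟩
    refine hp.mem_of_pow_mem k ((hmem _).mpr ?_)
    rw [map_pow]
    exact mul_mem_right _ _ hk
  · intro hr
    have h := (hmem r).mp hr
    rw [mul_comm] at h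
    exact ((Ideal.isPrimary_iff.mp (hprim hq)).2 h).resolve_left hyq

theorem finite_setOf_isPrime_mem_iff_mul_mem_pow [IsNoetherianRing R] (J : Ideal R) :
    {p : Ideal R | p.IsPrime ∧ ∃ k x, ∀ r, r ∈ p ↔ r * x ∈ J ^ k}.Finite := by
  classical
  let T : Ideal (reesAlgebra J) :=
    { carrier := {f | ∀ i, (f : R[X]).coeff i ∈ J ^ (i + 1)}
      zero_mem' := fun i => by simp
      add_mem' := fun {f g} hf hg i => by
        rw [Subalgebra.coe_add, coeff_add]
        exact add_mem (hf i) (hg i)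
      smul_mem' := fun g f hf i => by
        rw [smul_eq_mul, Subalgebra.coe_mul, coeff_mul]
        refine Ideal.sum_mem _ fun ab hab => ?_
        rw [Finset.HasAntidiagonal.mem_antidiagonal] at hab
        have := mul_mem_mul ((mem_reesAlgebra_iff J _).mp g.2 ab.1) (hf ab.2)
        rwa [← pow_add, ← add_assoc, hab] at this }
  refine (finite_setOf_isPrime_mem_iff_map_mul_mem (algebraMap R (reesAlgebra J)) T).subset ?_
  rintro p ⟨hp, k, x, hx⟩
  have hk : ¬ ∃ r ∉ p, r * x ∈ J ^ k := by
    rintro ⟨r, hr, hrx⟩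
    exact hr ((hx r).mpr hrx)
  have hex : ∃ j, ¬ ∃ r ∉ p, r * x ∈ J ^ j := ⟨k, hk⟩
  obtain ⟨j, hj⟩ : ∃ j, Nat.find hex = j + 1 := by
    refine Nat.exists_eq_succ_of_ne_zero fun h => ?_
    have := Nat.find_spec hex
    rw [h] at this
    exact this ⟨1, (ne_top_iff_one p).mp hp.ne_top, by simp⟩
  have hj1 : ¬ ∃ r ∉ p, r * x ∈ J ^ (j + 1) := hj ▸ Nat.find_spec hex
  have hjk : j + 1 ≤ k := hj ▸ Nat.find_min' hex hk
  obtain ⟨r, hr, hrx⟩ : ∃ r ∉ p, r * x ∈ J ^ j :=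
    not_not.mp (Nat.find_min hex (show j < Nat.find hex by omega))
  refine ⟨hp, ⟨monomial j (r * x), reesAlgebra.monomial_mem.mpr hrx⟩, fun z => ?_⟩
  have hT : algebraMap R (reesAlgebra J) z *
      ⟨monomial j (r * x), reesAlgebra.monomial_mem.mpr hrx⟩ ∈ T ↔ z * (r * x) ∈ J ^ (j + 1) := by
    change (∀ i, (algebraMap R R[X] z * monomial j (r * x)).coeff i ∈ J ^ (i + 1)) ↔ _
    simp only [algebraMap_eq, coeff_C_mul, coeff_monomial]
    constructor
    · intro h
      simpa using h j
    · intro h i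
      split_ifs with hi
      · rwa [← hi]
      · simp
  rw [hT]
  constructor
  · intro hz
    have := mul_mem_left _ r ((hx z).mp hz)
    rw [mul_left_comm] at this
    exact Ideal.pow_le_pow_right hjk this
  · intro hz
    by_contra hzp
    refine hj1 ⟨z * r, fun h => (hp.mem_or_mem h).elim hzp hr, ?_⟩
    rwa [mul_assoc]

theorem IsPrime.exists_notMem_forall_mul_mem [IsNoetherianRing R] {p : Ideal R} (hp : p.IsPrime)
    {L T : Ideal R} (h : ∀ z ∈ L, ∃ s ∉ p, s * z ∈ T) : ∃ s ∉ p, ∀ z ∈ L, s * z ∈ T := by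
  classical
  obtain ⟨t, rfl⟩ := IsNoetherian.noetherian L
  induction t using Finset.induction_on with
  | empty =>
    refine ⟨1, (ne_top_iff_one p).mp hp.ne_top, fun z hz => ?_⟩
    have : z = 0 := by simpa using hz
    simp [this]
  | insert a t _ ih =>
    rw [Finset.coe_insert, Submodule.span_insert] at h ⊢
    obtain ⟨s, hs, hsT⟩ := ih fun z hz => h z (Submodule.mem_sup_right hz)
    obtain ⟨s', hs', hsT'⟩ := h a (Submodule.mem_sup_left (mem_span_singleton_self a))
    refine ⟨s * s', fun hm => (hp.mem_or_mem hm).elim hs hs', fun z hz => ?_⟩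
    obtain ⟨u, hu, v, hv, rfl⟩ := Submodule.mem_sup.mp hz
    obtain ⟨w, rfl⟩ := mem_span_singleton'.mp hu
    rw [mul_add]
    refine add_mem ?_ ?_
    · rw [show s * s' * (w * a) = s * w * (s' * a) by ring]
      exact mul_mem_left _ _ hsT'
    · rw [show s * s' * v = s' * (s * v) by ring]
      exact mul_mem_left _ _ (hsT v hv)

theorem IsPrime.exists_notMem_mul_mem_pow [IsNoetherianRing R] {J p : Ideal R} (hp : p.IsPrime)
    {k : ℕ} (hpk : ¬ ∃ x, ∀ r, r ∈ p ↔ r * x ∈ J ^ k) (m : ℕ) {y : R}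
    (h : ∀ z ∈ p ^ m, z * y ∈ J ^ k) : ∃ s ∉ p, s * y ∈ J ^ k := by
  induction m generalizing y with
  | zero => exact ⟨1, (ne_top_iff_one p).mp hp.ne_top, h 1 (by simp)⟩
  | succ m ih =>
    have h1 : ∀ w ∈ p * span {y}, ∃ s ∉ p, s * w ∈ J ^ k := by
      intro w hw
      obtain ⟨z, hz, rfl⟩ := mem_mul_span_singleton.mp hw
      refine ih fun v hv => ?_
      rw [← mul_assoc]
      refine h _ ?_
      rw [pow_succ]
      exact mul_mem_mul hv hz
    obtain ⟨s, hs, hsp⟩ := hp.exists_notMem_forall_mul_mem h1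
    by_contra hno
    refine hpk ⟨s * y, fun r => ⟨fun hr => ?_, fun hr => ?_⟩⟩
    · rw [mul_left_comm]
      exact hsp _ (mem_mul_span_singleton.mpr ⟨r, hr, rfl⟩)
    · by_contra hrp
      refine hno ⟨r * s, fun hm => (hp.mem_or_mem hm).elim hrp hs, ?_⟩
      rwa [mul_assoc]

theorem mem_assQuot_iff {J : Ideal R} {p : Ideal R} :
    p ∈ assQuot (J : Set R) ↔ p.IsPrime ∧ ∃ x, ∀ r, r ∈ p ↔ r * x ∈ J := by
  simp [assQuot, Set.ext_iff]

theorem mem_assQuot₂_iff {K J p : Ideal R} :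
    p ∈ assQuot₂ (K : Set R) (J : Set R) ↔
      p.IsPrime ∧ ∃ x ∈ K, ∀ r, r ∈ p ↔ r * x ∈ J := by
  simp [assQuot₂, Set.ext_iff]

theorem exists_mem_iff_mul_mem_pow_of_mem_assQuot [IsNoetherianRing R] {J p : Ideal R} {n : ℕ}
    (h : p ∈ assQuot ((J ^ n).intClosureIdeal : Set R)) :
    ∃ k x, ∀ r, r ∈ p ↔ r * x ∈ J ^ k := by
  obtain ⟨hp, x, hx⟩ := mem_assQuot_iff.mp h
  by_contra hno
  push Not at hno
  have hL : ((p * span {x} : Ideal R) : Set R) ⊆ (J ^ n).intClosure := by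
    intro w hw
    obtain ⟨z, hz, rfl⟩ := mem_mul_span_singleton.mp hw
    exact (hx z).mp hz
  obtain ⟨c, hc⟩ := (isReductionOfSup_of_subset_intClosure hL).mono le_rfl
  obtain ⟨s, hs, hsx⟩ := exists_mul_mem_intClosure (H := J ^ n) (x := x) p.primeCompl c fun m => by
    obtain ⟨s, hs, h⟩ := hp.exists_notMem_mul_mem_pow (J := J) (k := n * (m - c)) (y := x ^ m)
      (by rintro ⟨y, hy⟩; obtain ⟨r, hr⟩ := hno _ y; have := hy r; tauto) m (fun z hz => by
        rw [pow_mul]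
        refine hc m ?_
        rw [mul_pow, span_singleton_pow]
        exact mul_mem_mul hz (mem_span_singleton_self _))
    exact ⟨s, hs, by rwa [← pow_mul]⟩
  exact hs ((hx s).mpr hsx)

/-- If `x J` is integral over `J ^ (n + 1)`, then some monic polynomial with coefficients in the
powers of `J ^ n` takes at `x` a value annihilated by a power of `J`. -/
theorem exists_monic_eval_mul_eq_zero [IsNoetherianRing R] {J : Ideal R} {n : ℕ} {x : R}
    (hx : ∀ j ∈ J, x * j ∈ (J ^ (n + 1)).intClosureIdeal) :
    ∃ f : R[X], f.Monic ∧ (∀ i, f.coeff i ∈ (J ^ n) ^ (f.natDegree - i)) ∧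
      ∃ h : ℕ, ∀ y ∈ J ^ h, f.eval x * y = 0 := by
  have hL : ((J * span {x} : Ideal R) : Set R) ⊆ (J ^ (n + 1)).intClosure := by
    intro w hw
    obtain ⟨z, hz, rfl⟩ := mem_mul_span_singleton.mp hw
    rw [mul_comm]
    exact hx z hz
  obtain ⟨k, hk⟩ := isReductionOfSup_of_subset_intClosure hL
  have hW : J ^ (n + 1) ⊔ J * span {x} = J * (J ^ n ⊔ span {x}) := by
    rw [mul_sup, pow_succ']
  rw [hW, mul_pow, mul_pow] at hk
  set V := J ^ n ⊔ span {x} with hV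
  set M : Ideal R := J ^ (k + 1) * V ^ k with hM
  have hxM : ∀ m ∈ M, x * m ∈ J ^ n * M := by
    intro m hm
    have h1 : x * m ∈ V * M := mul_mem_mul (le_sup_right (a := J ^ n) (mem_span_singleton_self x)) hm
    have h2 : V * M ≤ J ^ n * M := by
      calc V * M = J ^ (k + 1) * V ^ (k + 1) := by rw [hM, pow_succ' V]; ring
        _ ≤ J ^ (n + 1) * (J ^ k * V ^ k) := hk
        _ = J ^ n * M := by rw [hM]; ring
    exact h2 h1
  obtain ⟨f, hf, -, hc, h0⟩ :=
    LinearMap.exists_monic_and_natDegree_eq_and_coeff_mem_pow_and_aeval_eq_zero R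
      (algebraMap R (Module.End R M) x) (J ^ n) (by
        rintro _ ⟨m, rfl⟩
        rw [Submodule.mem_smul_top_iff]
        exact hxM m m.2)
  refine ⟨f, hf, hc, k + 1 + n * k, fun y hy => ?_⟩
  have hyM : y ∈ M := by
    have : J ^ (k + 1 + n * k) ≤ M := by
      rw [pow_add, pow_mul, hM]
      gcongr
      exact le_sup_left
    exact this hy
  rw [aeval_algebraMap_apply] at h0
  have := congrArg (fun g : Module.End R M => ((g ⟨y, hyM⟩ : M) : R)) h0
  simpa [Module.algebraMap_end_apply] using this

theorem mem_intClosureIdeal_of_isNilpotent_pow_mul_eval [IsNoetherianRing R] {H : Ideal R} {x : R}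
    {f : R[X]} (hf : f.Monic) (hc : ∀ i, f.coeff i ∈ H ^ (f.natDegree - i)) (k : ℕ)
    (hx : IsNilpotent (x ^ k * f.eval x)) : x ∈ H.intClosureIdeal := by
  refine mem_intClosure_of_monic (f := X ^ k * f) ((monic_X_pow k).mul hf) (fun i => ?_)
    (by simpa using hx)
  rw [coeff_X_pow_mul']
  split_ifs with hi
  · refine Ideal.pow_le_pow_right ?_ (hc (i - k))
    have h1 : (X ^ k * f).natDegree ≤ k + f.natDegree :=
      natDegree_mul_le.trans (Nat.add_le_add_right (natDegree_X_pow_le k) _)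
    omega
  · exact zero_mem _

theorem isNilpotent_of_mem_intClosureIdeal [IsNoetherianRing R] {J : Ideal R} {n h : ℕ}
    (hn : 1 ≤ n) {g : R} (hg : g ∈ (J ^ n).intClosureIdeal) (h0 : ∀ y ∈ J ^ h, g * y = 0) :
    IsNilpotent g := by
  obtain ⟨c, hc⟩ := mem_intClosure_iff_s7.mp hg
  refine ⟨c + h + 1, ?_⟩
  rw [pow_succ']
  refine h0 _ ?_
  have h1 := hc (c + h)
  rw [Nat.add_sub_cancel_left, ← pow_mul] at h1
  exact Ideal.pow_le_pow_right (Nat.le_mul_of_pos_left h hn) h1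

/-- The preimage in `R` of the integral closure of the extension of `H` to `R ⧸ A`. -/
def quotIntClosure [IsNoetherianRing R] (A H : Ideal R) : Ideal R :=
  comap (Quotient.mk A) (H.map (Quotient.mk A)).intClosureIdeal

theorem assQuot₂_quotIntClosure_subset_succ [IsNoetherianRing R] (A J : Ideal R) {n : ℕ}
    (hn : 1 ≤ n) :
    assQuot₂ (quotIntClosure A (J ^ n) : Set R) ((J ^ n).intClosureIdeal : Set R) ⊆
      assQuot₂ (quotIntClosure A (J ^ (n + 1)) : Set R)
        ((J ^ (n + 1)).intClosureIdeal : Set R) := by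
  intro p h
  obtain ⟨hp, x, hxA, hx⟩ := mem_assQuot₂_iff.mp h
  refine mem_assQuot₂_iff.mpr ⟨hp, ?_⟩
  by_cases hj : ∃ j ∈ J, ∀ s ∉ p, s * (x * j) ∉ (J ^ (n + 1)).intClosureIdeal
  · obtain ⟨j, hj, hs⟩ := hj
    refine ⟨x * j, ?_, fun r => ⟨fun hr => ?_, fun hr => by_contra fun hrp => hs r hrp hr⟩⟩
    · rw [quotIntClosure, mem_comap, Ideal.map_pow] at hxA ⊢
      rw [map_mul]
      exact mul_mem_intClosureIdeal_pow_succ (mem_map_of_mem _ hj) hxA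
    · rw [← mul_assoc]
      exact mul_mem_intClosureIdeal_pow_succ hj ((hx r).mp hr)
  push Not at hj
  obtain ⟨s, hs, hsx⟩ : ∃ s ∉ p, ∀ z ∈ J * span {x}, s * z ∈ (J ^ (n + 1)).intClosureIdeal := by
    refine hp.exists_notMem_forall_mul_mem fun z hz => ?_
    obtain ⟨j, hjJ, rfl⟩ := mem_mul_span_singleton.mp hz
    rw [mul_comm j x]
    exact hj j hjJ
  obtain ⟨f, hf, hc, e, h0⟩ := exists_monic_eval_mul_eq_zero (J := J) (n := n) (x := s * x)
    fun j hjJ => by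
      rw [mul_assoc, mul_comm x j]
      exact hsx _ (mem_mul_span_singleton.mpr ⟨j, hjJ, rfl⟩)
  have hx' : ∀ r, r ∈ p ↔ r * (s * x) ∈ (J ^ n).intClosureIdeal := fun r => by
    rw [← mul_assoc, ← hx]
    exact ⟨fun hr => mul_mem_right _ _ hr, fun hr => (hp.mem_or_mem hr).resolve_right hs⟩
  have hxA' : s * x ∈ quotIntClosure A (J ^ n) := mul_mem_left _ _ hxA
  generalize s * x = y at h0 hx' hxA'
  refine ⟨y * f.eval y, ?_, fun r => ⟨fun hr => ?_, fun hr => ?_⟩⟩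
  · have h1 : y * f.eval y ∈ quotIntClosure A (J ^ n) := mul_mem_right _ _ hxA'
    rw [quotIntClosure, mem_comap, Ideal.map_pow] at h1 ⊢
    refine mem_intClosureIdeal_of_isNilpotent _
      (isNilpotent_of_mem_intClosureIdeal (h := e) hn h1 fun z hz => ?_)
    rw [← Ideal.map_pow] at hz
    obtain ⟨w, hw, rfl⟩ := (mem_map_iff_of_surjective _ Quotient.mk_surjective).mp hz
    rw [← map_mul, mul_assoc, h0 w hw, mul_zero, map_zero]
  · have h1 : r * (y * f.eval y) ∈ (J ^ n).intClosureIdeal := by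
      rw [← mul_assoc]
      exact mul_mem_right _ _ ((hx' r).mp hr)
    refine mem_intClosureIdeal_of_isNilpotent _
      (isNilpotent_of_mem_intClosureIdeal (h := e) hn h1 fun z hz => ?_)
    rw [mul_assoc, mul_assoc, h0 z hz, mul_zero, mul_zero]
  · have h1 : IsNilpotent (r * (y * f.eval y)) :=
      isNilpotent_of_mem_intClosureIdeal (h := e) (Nat.le_add_left 1 n) hr fun z hz => by
        rw [mul_assoc, mul_assoc, h0 z hz, mul_zero, mul_zero]
    rw [hx']
    refine mem_intClosureIdeal_of_isNilpotent_pow_mul_eval (f := f.scaleRoots r)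
      ((monic_scaleRoots_iff r).mpr hf) (fun i => ?_) 1 ?_
    · rw [coeff_scaleRoots, natDegree_scaleRoots]
      exact mul_mem_right _ _ (hc i)
    · rw [scaleRoots_eval_mul]
      have h2 := (Commute.all (r ^ f.natDegree) _).isNilpotent_mul_left h1
      convert h2 using 1
      ring

theorem exists_forall_eq_of_subset_succ {α : Type} {u : ℕ → Set α} {F : Set α} (hF : F.Finite)
    (hu : ∀ n, 1 ≤ n → u n ⊆ F) (hs : ∀ n, 1 ≤ n → u n ⊆ u (n + 1)) :
    ∃ n₀, 1 ≤ n₀ ∧ ∀ n, n₀ ≤ n → u n = u n₀ := by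
  classical
  have hmono : ∀ a b, 1 ≤ a → a ≤ b → u a ⊆ u b := fun a b ha hab => by
    induction b, hab using Nat.le_induction with
    | base => exact subset_rfl
    | succ b hb ih => exact ih.trans (hs b (ha.trans hb))
  have hN : ∀ a, ∃ N, 1 ≤ N ∧ ∀ n, 1 ≤ n → a ∈ u n → a ∈ u N := fun a => by
    by_cases h : ∃ n, 1 ≤ n ∧ a ∈ u n
    · obtain ⟨n, hn, ha⟩ := h
      exact ⟨n, hn, fun _ _ _ => ha⟩
    · exact ⟨1, le_rfl, fun n hn ha => (h ⟨n, hn, ha⟩).elim⟩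
  choose N hN1 hN using hN
  have h1 : 1 ≤ 1 + hF.toFinset.sup N := Nat.le_add_right _ _
  refine ⟨1 + hF.toFinset.sup N, h1, fun n hn =>
    Set.Subset.antisymm (fun a ha => ?_) (hmono _ _ h1 hn)⟩
  have haF := hu n (h1.trans hn) ha
  have hle : N a ≤ hF.toFinset.sup N := Finset.le_sup (hF.mem_toFinset.mpr haF)
  exact hmono _ _ (hN1 a) (by omega) (hN a n (h1.trans hn) ha)

theorem exists_forall_assQuot₂_quotIntClosure_eq [IsNoetherianRing R] (A J : Ideal R) :
    ∃ n₀, 1 ≤ n₀ ∧ ∀ n, n₀ ≤ n →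
      assQuot₂ (quotIntClosure A (J ^ n) : Set R) (J ^ n).intClosure =
        assQuot₂ (quotIntClosure A (J ^ n₀) : Set R) (J ^ n₀).intClosure := by
  refine exists_forall_eq_of_subset_succ
    (u := fun n => assQuot₂ (quotIntClosure A (J ^ n) : Set R) (J ^ n).intClosure)
    (finite_setOf_isPrime_mem_iff_mul_mem_pow J) (fun n _ p hp => ?_)
    fun n hn => assQuot₂_quotIntClosure_subset_succ A J hn
  obtain ⟨hp, x, -, hx⟩ := hp
  exact ⟨hp, exists_mem_iff_mul_mem_pow_of_mem_assQuot (n := n) ⟨hp, x, hx⟩⟩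

theorem quotIntClosure_top [IsNoetherianRing R] (H : Ideal R) :
    (quotIntClosure ⊤ H : Set R) = Set.univ := by
  refine Set.eq_univ_of_forall fun x => ?_
  rw [SetLike.mem_coe, quotIntClosure, mem_comap, Quotient.eq_zero_iff_mem.mpr Submodule.mem_top]
  exact zero_mem _

/-- Ratliff's theorem: the associated primes of the integral closures of the powers of an ideal of
a Noetherian ring are eventually constant. -/
theorem exists_forall_assQuot_intClosure_pow_eq [IsNoetherianRing R] (J : Ideal R) :
    ∃ n₀, 1 ≤ n₀ ∧ ∀ n, n₀ ≤ n →
      assQuot (J ^ n).intClosure = assQuot (J ^ n₀).intClosure := by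
  simpa [quotIntClosure_top, assQuot, assQuot₂] using
    exists_forall_assQuot₂_quotIntClosure_eq ⊤ J

theorem assQuot_preimage_mk (A : Ideal R) (T : Set (R ⧸ A)) :
    assQuot (Quotient.mk A ⁻¹' T) = comap (Quotient.mk A) '' assQuot T := by
  ext p
  constructor
  · rintro ⟨hp, x, hx⟩
    have hx' : ∀ r, r ∈ p ↔ Quotient.mk A r * Quotient.mk A x ∈ T := fun r => by
      rw [← map_mul]
      exact Set.ext_iff.mp hx r
    have hAp : A ≤ p := fun a ha => by
      have h0 := (hx' 0).mp (zero_mem _)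
      rw [hx', Quotient.eq_zero_iff_mem.mpr ha]
      rwa [map_zero] at h0
    have hcm : comap (Quotient.mk A) (map (Quotient.mk A) p) = p := by
      rw [comap_map_of_surjective' _ Quotient.mk_surjective, mk_ker, sup_eq_left.mpr hAp]
    refine ⟨map (Quotient.mk A) p, ⟨map_isPrime_of_surjective Quotient.mk_surjective
      (by rwa [mk_ker]), Quotient.mk A x, ?_⟩, hcm⟩
    ext z
    obtain ⟨r, rfl⟩ := Quotient.mk_surjective z
    rw [Set.mem_ofPred_eq, ← hx', SetLike.mem_coe, ← mem_comap, hcm]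
  · rintro ⟨q, ⟨hq, y, hy⟩, rfl⟩
    obtain ⟨x, rfl⟩ := Quotient.mk_surjective y
    refine ⟨hq.comap _, x, ?_⟩
    ext r
    simpa using Set.ext_iff.mp hy (Quotient.mk A r)

theorem exists_forall_assQuot_quotIntClosure_eq [IsNoetherianRing R] (A J : Ideal R) :
    ∃ n₀, 1 ≤ n₀ ∧ ∀ n, n₀ ≤ n →
      assQuot (quotIntClosure A (J ^ n) : Set R) =
        assQuot (quotIntClosure A (J ^ n₀) : Set R) := by
  obtain ⟨n₀, h1, h⟩ := exists_forall_assQuot_intClosure_pow_eq (J.map (Quotient.mk A))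
  have key : ∀ n, assQuot (quotIntClosure A (J ^ n) : Set R) =
      comap (Quotient.mk A) '' assQuot (J.map (Quotient.mk A) ^ n).intClosure := fun n => by
    rw [← assQuot_preimage_mk, quotIntClosure, Ideal.map_pow]
    rfl
  exact ⟨n₀, h1, fun n hn => by rw [key, key, h n hn]⟩

section RelIntClosure

variable {N : Type} [AddCommGroup N] [Module R N]

theorem exists_monic_of_relIntDep [IsNoetherianRing R] [Module.Finite R N] {H : Ideal R} {x : R}
    (hx : H.RelIntDep N x) :
    ∃ f : R[X], f.Monic ∧ (∀ i, f.coeff i ∈ H ^ (f.natDegree - i)) ∧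
      ∃ k : ℕ, x ^ k * f.eval x ∈ Module.annihilator R N := by
  obtain ⟨n, hn, hx⟩ := hx
  let M : Submodule R N :=
    ⨆ i ∈ Finset.range n, x ^ (n - 1 - i) • (H ^ i • (⊤ : Submodule R N))
  have hmem : ∀ i < n, ∀ m ∈ H ^ i • (⊤ : Submodule R N), x ^ (n - 1 - i) • m ∈ M :=
    fun i hi m hm => (le_iSup₂ (f := fun i (_ : i ∈ Finset.range n) =>
      x ^ (n - 1 - i) • (H ^ i • (⊤ : Submodule R N))) i (Finset.mem_range.mpr hi))
      (Submodule.smul_mem_pointwise_smul _ _ _ hm)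
  have hsub : ∀ j, 1 ≤ j → j ≤ n →
      x ^ (n - j) • (H ^ j • (⊤ : Submodule R N)) ≤ H • M := by
    intro j hj hjn
    obtain ⟨i, rfl⟩ := Nat.exists_eq_add_of_le' hj
    rintro _ ⟨m, hm, rfl⟩
    rw [pow_succ', Submodule.mul_smul] at hm
    have hle : H • H ^ i • (⊤ : Submodule R N) ≤
        (H • M).comap (LinearMap.lsmul R N (x ^ (n - (i + 1)))) := by
      refine Submodule.smul_le.mpr fun r hr v hv => ?_
      rw [Submodule.mem_comap, map_smul]
      refine Submodule.smul_mem_smul hr ?_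
      rw [show n - (i + 1) = n - 1 - i by omega]
      exact hmem i (by omega) v hv
    exact hle hm
  have hxM : M ≤ (H • M).comap (LinearMap.lsmul R N x) := by
    refine iSup₂_le fun i hi => ?_
    rw [Finset.mem_range] at hi
    rintro _ ⟨m, hm, rfl⟩
    change x • x ^ (n - 1 - i) • m ∈ H • M
    rw [smul_smul, ← pow_succ', show n - 1 - i + 1 = n - i by omega]
    rcases Nat.eq_zero_or_pos i with h0 | h0
    · subst h0
      have hle : (⨆ i ∈ Finset.Icc 1 n, x ^ (n - i) • (H ^ i • (⊤ : Submodule R N))) ≤ H • M :=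
        iSup₂_le fun j hj => hsub j (Finset.mem_Icc.mp hj).1 (Finset.mem_Icc.mp hj).2
      exact hle (hx m)
    · exact hsub i h0 hi.le (Submodule.smul_mem_pointwise_smul _ _ _ hm)
  obtain ⟨f, hf, -, hc, h0⟩ :=
    LinearMap.exists_monic_and_natDegree_eq_and_coeff_mem_pow_and_aeval_eq_zero R
      (algebraMap R (Module.End R M) x) H (by
        rintro _ ⟨m, rfl⟩
        rw [Submodule.mem_smul_top_iff]
        exact hxM m.2)
  refine ⟨f, hf, hc, n - 1, Module.mem_annihilator.mpr fun v => ?_⟩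
  have hv : x ^ (n - 1) • v ∈ M := by
    simpa using hmem 0 hn v (by simp)
  rw [aeval_algebraMap_apply] at h0
  have := congrArg (fun g : Module.End R M => ((g ⟨_, hv⟩ : M) : N)) h0
  rw [mul_comm, mul_smul]
  simpa [Module.algebraMap_end_apply] using this

theorem relIntClosure_eq_quotIntClosure [IsNoetherianRing R] [Module.Finite R N] (H : Ideal R) :
    H.relIntClosure N = quotIntClosure (Module.annihilator R N) H := by
  set A := Module.annihilator R N with hA
  ext x
  rw [SetLike.mem_coe, quotIntClosure, mem_comap]
  constructor
  · intro hx
    obtain ⟨f, hf, hc, k, hk⟩ := exists_monic_of_relIntDep hx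
    refine mem_intClosureIdeal_of_isNilpotent_pow_mul_eval (f := f.map (Quotient.mk A))
      (hf.map _) (fun i => ?_) k ?_
    · rw [coeff_map, ← Ideal.map_pow]
      exact mem_map_of_mem _ (Ideal.pow_le_pow_right
        (Nat.sub_le_sub_right (natDegree_map_le) i) (hc i))
    · rw [eval_map_apply, ← map_pow, ← map_mul, Quotient.eq_zero_iff_mem.mpr hk]
      exact IsNilpotent.zero
  · rintro ⟨n, hn, r, hr, h⟩
    have hlift : ∀ i, ∃ a : R, i ∈ Finset.Icc 1 n → a ∈ H ^ i ∧ Quotient.mk A a = r i := fun i => by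
      by_cases hi : i ∈ Finset.Icc 1 n
      · have h1 := hr i hi
        rw [← Ideal.map_pow] at h1
        obtain ⟨a, ha, har⟩ := (mem_map_iff_of_surjective _ Quotient.mk_surjective).mp h1
        exact ⟨a, fun _ => ⟨ha, har⟩⟩
      · exact ⟨0, fun h => (hi h).elim⟩
    choose a ha using hlift
    refine ⟨n, hn, fun m => ?_⟩
    have hmk : x ^ n + ∑ i ∈ Finset.Icc 1 n, a i * x ^ (n - i) ∈ A := by
      rw [← Quotient.eq_zero_iff_mem, ← h, map_add, map_pow, map_sum]
      congr 1
      refine Finset.sum_congr rfl fun i hi => ?_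
      rw [map_mul, map_pow, (ha i hi).2]
    have h0 := Module.mem_annihilator.mp hmk m
    rw [add_smul] at h0
    rw [eq_neg_of_add_eq_zero_left h0, Finset.sum_smul]
    refine neg_mem (Submodule.sum_mem _ fun i hi => ?_)
    refine (le_iSup₂ (f := fun i (_ : i ∈ Finset.Icc 1 n) =>
      x ^ (n - i) • (H ^ i • (⊤ : Submodule R N))) i hi) ?_
    rw [mul_comm, mul_smul]
    exact Submodule.smul_mem_pointwise_smul _ _ _
      (Submodule.smul_mem_smul (ha i hi).1 Submodule.mem_top)

end RelIntClosure

theorem quotIntClosure_sup_pow [IsNoetherianRing R] (A I : Ideal R) (n : ℕ) :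
    quotIntClosure A ((I ⊔ A) ^ n) = quotIntClosure A (I ^ n) := by
  rw [quotIntClosure, quotIntClosure, Ideal.map_pow, Ideal.map_pow, Ideal.map_sup, map_quotient_self,
    sup_bot_eq]

theorem assQuot_sdiff_subset {K J : Ideal R} (h : J ≤ K) :
    assQuot (J : Set R) \ assQuot₂ (K : Set R) (J : Set R) ⊆ assQuot (K : Set R) := by
  rintro p ⟨h1, h2⟩
  obtain ⟨hp, x, hx⟩ := mem_assQuot_iff.mp h1
  refine mem_assQuot_iff.mpr ⟨hp, x, fun r => ⟨fun hr => h ((hx r).mp hr), fun hr => ?_⟩⟩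
  by_contra hrp
  refine h2 (mem_assQuot₂_iff.mpr ⟨hp, r * x, hr, fun z => ?_⟩)
  rw [← mul_assoc, ← hx]
  exact ⟨fun hz => mul_mem_right _ _ hz, fun hz => (hp.mem_or_mem hz).resolve_right hrp⟩

end Ideal

/-- `A*_a(I + Ann_R N) ∖ C*_a(I, N) ⊆ A*_a(I, N)`: eventually the three sequences of
associated primes are constant, and every prime in the first eventual value that is not in
the second lies in the third. -/
theorem eventual_assQuot_sdiff_subset {R : Type} [CommRing R] [IsNoetherianRing R]
    (N : Type) [AddCommGroup N] [Module R N] [Module.Finite R N] (I : Ideal R) :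
    ∃ n₀ : ℕ, 1 ≤ n₀ ∧
      (∀ n : ℕ, n₀ ≤ n →
        assQuot (((I + Module.annihilator R N) ^ n).intClosure) =
          assQuot (((I + Module.annihilator R N) ^ n₀).intClosure) ∧
        assQuot₂ ((I ^ n).relIntClosure N) (((I + Module.annihilator R N) ^ n).intClosure) =
          assQuot₂ ((I ^ n₀).relIntClosure N)
            (((I + Module.annihilator R N) ^ n₀).intClosure) ∧
        assQuot ((I ^ n).relIntClosure N) = assQuot ((I ^ n₀).relIntClosure N)) ∧
      assQuot (((I + Module.annihilator R N) ^ n₀).intClosure) \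
          assQuot₂ ((I ^ n₀).relIntClosure N)
            (((I + Module.annihilator R N) ^ n₀).intClosure) ⊆
        assQuot ((I ^ n₀).relIntClosure N) := by
  set A := Module.annihilator R N
  have hrel : ∀ n, (I ^ n).relIntClosure N = (Ideal.quotIntClosure A ((I + A) ^ n) : Set R) :=
    fun n => by
      rw [Ideal.relIntClosure_eq_quotIntClosure, Submodule.add_eq_sup, Ideal.quotIntClosure_sup_pow]
  simp only [hrel]
  obtain ⟨a, ha1, ha⟩ := Ideal.exists_forall_assQuot_intClosure_pow_eq (I + A)
  obtain ⟨b, -, hb⟩ := Ideal.exists_forall_assQuot₂_quotIntClosure_eq A (I + A)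
  obtain ⟨c, -, hc⟩ := Ideal.exists_forall_assQuot_quotIntClosure_eq A (I + A)
  refine ⟨a + b + c, by omega, fun n hn => ⟨?_, ?_, ?_⟩, ?_⟩
  · rw [ha n (by omega), ha (a + b + c) (by omega)]
  · rw [hb n (by omega), hb (a + b + c) (by omega)]
  · rw [hc n (by omega), hc (a + b + c) (by omega)]
  · exact Ideal.assQuot_sdiff_subset
      (J := ((I + A) ^ (a + b + c)).intClosureIdeal) fun x hx => Ideal.map_mem_intClosureIdeal _ hx
end

section
/- Let R be a Noetherian commutative ring, N a finitely generated R-module, and I and J ideals of R. Then ⋂_{n≥1} ((I^n)^{(N)}_a :_R ⟨J⟩) = ⋂ { p : p ∈ mAss_R N and J ⊄ Rad(I + p) }. -/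
open Pointwise

/-- If `x` is integrally dependent on `I` relative to `N`, then `x ^ j N ⊆ I ^ (j - d) N` for some
fixed `d` and all `j`. -/
theorem Ideal.RelIntDep.exists_pow_smul_mem {R : Type} [CommRing R] {I : Ideal R} {N : Type}
    [AddCommGroup N] [Module R N] {x : R} (h : I.RelIntDep N x) :
    ∃ d : ℕ, ∀ (j : ℕ) (v : N), x ^ j • v ∈ I ^ (j - d) • (⊤ : Submodule R N) := by
  obtain ⟨d, hd, h⟩ := h
  refine ⟨d, fun j ↦ ?_⟩
  induction j using Nat.strong_induction_on with
  | _ j ih =>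
    intro v
    rcases le_or_gt j d with hj | hj
    · simp [Nat.sub_eq_zero_of_le hj]
    · have hle : (⨆ i ∈ Finset.Icc 1 d, x ^ (d - i) • (I ^ i • (⊤ : Submodule R N))) ≤
          (I ^ (j - d) • (⊤ : Submodule R N)).comap (LinearMap.lsmul R N (x ^ (j - d))) := by
        refine iSup₂_le fun i hi w hw ↦ ?_
        obtain ⟨hi1, hid⟩ := Finset.mem_Icc.mp hi
        obtain ⟨u, hu, rfl⟩ := (Submodule.mem_smul_pointwise_iff_exists _ _ _).mp hw
        rw [Submodule.mem_comap, LinearMap.lsmul_apply, smul_smul, ← pow_add,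
          show j - d + (d - i) = j - i by omega]
        have hmem : x ^ (j - i) • u ∈ I ^ i • (I ^ (j - i - d) • (⊤ : Submodule R N)) := by
          refine Submodule.smul_induction_on hu (fun r hr n _ ↦ ?_) fun a b ha hb ↦ ?_
          · rw [smul_comm (x ^ (j - i)) r n]
            exact Submodule.smul_mem_smul hr (ih (j - i) (by omega) n)
          · rw [smul_add]
            exact add_mem ha hb
        rw [← mul_smul, ← pow_add] at hmem
        exact Submodule.smul_mono_left (Ideal.pow_le_pow_right (by omega)) hmem
      have := hle (h v)
      rwa [Submodule.mem_comap, LinearMap.lsmul_apply, smul_smul, ← pow_add,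
        Nat.sub_add_cancel hj.le] at this

/-- If a product of factors `x - a i` with `a i ∈ I` annihilates `N`, then `x` is integrally
dependent on `I` relative to `N`. -/
theorem Ideal.relIntDep_of_prod_sub_mem_annihilator {R : Type} [CommRing R] {I : Ideal R}
    {N : Type} [AddCommGroup N] [Module R N] {x : R} {ι : Type*} (s : Finset ι) (a : ι → R)
    (ha : ∀ i ∈ s, a i ∈ I) (h : ∏ i ∈ s, (x - a i) ∈ Module.annihilator R N) :
    I.RelIntDep N x := by
  classical
  rw [Module.mem_annihilator] at h
  rcases s.eq_empty_or_nonempty with rfl | hs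
  · refine ⟨1, one_pos, fun v ↦ ?_⟩
    have hv : v = 0 := by simpa using h v
    simp [hv]
  · refine ⟨s.card, hs.card_pos, fun v ↦ ?_⟩
    have key := h v
    simp only [sub_eq_add_neg] at key
    rw [Finset.prod_add, ← Finset.add_sum_erase _ _ (Finset.mem_powerset_self s), add_smul,
      Finset.sdiff_self, Finset.prod_empty, mul_one, Finset.prod_const] at key
    rw [eq_neg_of_add_eq_zero_left key, Finset.sum_smul]
    refine Submodule.neg_mem _ (Submodule.sum_mem _ fun t ht ↦ ?_)
    obtain ⟨hts, hsub⟩ := Finset.mem_erase.mp ht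
    rw [Finset.mem_powerset] at hsub
    have hlt : t.card < s.card := Finset.card_lt_card (hsub.ssubset_of_ne hts)
    have hcard : (s \ t).card = s.card - t.card := Finset.card_sdiff_of_subset hsub
    have hmem : (s \ t).card ∈ Finset.Icc 1 s.card := by
      rw [Finset.mem_Icc]
      omega
    refine Submodule.mem_iSup_of_mem _ (Submodule.mem_iSup_of_mem hmem ?_)
    rw [Finset.prod_const, mul_smul, show s.card - (s \ t).card = t.card by omega]
    refine Submodule.smul_mem_pointwise_smul _ _ _
      (Submodule.smul_mem_smul ?_ Submodule.mem_top)
    rw [← Finset.prod_const]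
    exact Ideal.prod_mem_prod fun i hi ↦ neg_mem (ha i (Finset.mem_sdiff.mp hi).1)

/-- A consequence of the Artin-Rees lemma: if `R ∙ e ≅ R ⧸ p` with `p` prime and `x ∉ p`, then
cancelling `x` lowers the `I`-adic order on `R ∙ e` by a bounded amount. -/
theorem Ideal.exists_cancel_smul_mem_pow {R N : Type*} [CommRing R] [IsNoetherianRing R]
    [AddCommGroup N] [Module R N] [Module.Finite R N] (I p : Ideal R) [hp : p.IsPrime] {e : N}
    (he : ∀ r : R, r • e = 0 ↔ r ∈ p) {x : R} (hx : x ∉ p) :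
    ∃ c : ℕ, ∀ (s : ℕ) (r : R), x • r • e ∈ I ^ s • (⊤ : Submodule R N) →
      ∃ a ∈ I ^ (s - c), r • e = a • e := by
  obtain ⟨c, hc⟩ := I.exists_pow_inf_eq_pow_smul (Submodule.span R {x • e})
  refine ⟨c, fun s r h ↦ ?_⟩
  rcases le_total s c with hsc | hsc
  · exact ⟨r, by simp [Nat.sub_eq_zero_of_le hsc], rfl⟩
  · have hmem : x • r • e ∈ I ^ s • ⊤ ⊓ Submodule.span R {x • e} :=
      ⟨h, Submodule.mem_span_singleton.mpr ⟨r, smul_comm _ _ _⟩⟩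
    rw [hc s hsc] at hmem
    obtain ⟨a, ha, hae⟩ := Submodule.mem_smul_span_singleton.mp
      (Submodule.smul_mono le_rfl inf_le_right hmem)
    refine ⟨a, ha, ?_⟩
    have hzero : (x * (r - a)) • e = 0 := by
      rw [mul_smul, sub_smul, smul_sub, ← hae, smul_comm, sub_self]
    have := (he _).mpr ((hp.mem_or_mem ((he _).mp hzero)).resolve_left hx)
    rwa [sub_smul, sub_eq_zero] at this

theorem Ideal.exists_cancel_pow_smul_mem_pow {R N : Type*} [CommRing R] [IsNoetherianRing R]
    [AddCommGroup N] [Module R N] [Module.Finite R N] (I p : Ideal R) [p.IsPrime] {e : N}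
    (he : ∀ r : R, r • e = 0 ↔ r ∈ p) {x : R} (hx : x ∉ p) :
    ∃ c : ℕ, ∀ (k s : ℕ) (r : R), x ^ (k + 1) • r • e ∈ I ^ s • (⊤ : Submodule R N) →
      ∃ a ∈ I ^ (s - c * (k + 1)), r • e = a • e := by
  obtain ⟨c, hc⟩ := I.exists_cancel_smul_mem_pow p he hx
  refine ⟨c, fun k ↦ ?_⟩
  induction k with
  | zero => simpa using hc
  | succ k ih =>
    intro s r h
    rw [pow_succ, mul_smul, ← mul_smul x] at h
    obtain ⟨a, ha, hae⟩ := ih s (x * r) h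
    rw [mul_smul] at hae
    obtain ⟨b, hb, hbe⟩ := hc _ r (hae ▸ Submodule.smul_mem_smul ha Submodule.mem_top)
    refine ⟨b, ?_, hbe⟩
    rwa [Nat.sub_sub, ← Nat.mul_succ] at hb

theorem mem_of_forall_mem_colonPow_relIntClosure_pow {R : Type} [CommRing R]
    [IsNoetherianRing R] {N : Type} [AddCommGroup N] [Module R N] [Module.Finite R N]
    {I J p : Ideal R} {x : R} (hx : ∀ n, 1 ≤ n → x ∈ colonPow ((I ^ n).relIntClosure N) J)
    (hp : p ∈ associatedPrimes R N) (hJ : ¬ J ≤ (I + p).radical) : x ∈ p := by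
  by_contra hxp
  obtain ⟨hprime, e, hpe⟩ := isAssociatedPrime_iff.mp (AssociatedPrimes.mem_iff.mp hp)
  have he : ∀ r : R, r • e = 0 ↔ r ∈ p := fun r ↦ by
    rw [hpe, Submodule.mem_colon_singleton, Submodule.mem_bot]
  obtain ⟨y, hyJ, hy⟩ := SetLike.not_le_iff_exists.mp hJ
  obtain ⟨c, hc⟩ := I.exists_cancel_pow_smul_mem_pow p he hxp
  obtain ⟨m, -, hm⟩ := hx (c + 1) (by omega)
  obtain ⟨d, hd⟩ := Ideal.RelIntDep.exists_pow_smul_mem (hm _ (Ideal.pow_mem_pow hyJ m))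
  have hmem := hd (c * d + d + 1) e
  rw [← pow_mul, mul_pow, mul_smul] at hmem
  obtain ⟨a, ha, hae⟩ := hc _ _ _ hmem
  have hexp : (c + 1) * (c * d + d + 1 - d) - c * (c * d + d + 1) = 1 := by
    rw [show c * d + d + 1 - d = c * d + 1 by omega]
    refine Nat.sub_eq_of_eq_add ?_
    ring
  rw [hexp, pow_one] at ha
  have hsub := (he ((y ^ m) ^ (c * d + d + 1) - a)).mp (by rw [sub_smul, hae, sub_self])
  refine hy ⟨m * (c * d + d + 1), ?_⟩
  rw [pow_mul, ← add_sub_cancel a ((y ^ m) ^ (c * d + d + 1))]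
  exact Submodule.add_mem_sup ha hsub

theorem minimalPrimes_annihilator_subset_mAss {R : Type} [CommRing R] [IsNoetherianRing R]
    (N : Type) [AddCommGroup N] [Module R N] [Module.Finite R N] :
    (Module.annihilator R N).minimalPrimes ⊆ mAss R N := fun _ hq ↦
  ⟨Module.associatedPrimes.minimalPrimes_annihilator_subset_associatedPrimes R N hq,
    fun _ hq' hle ↦ hq.2 ⟨hq'.isPrime,
      Submodule.annihilator_top (R := R) (M := N) ▸ hq'.annihilator_le⟩ hle⟩

theorem mem_colonPow_relIntClosure_of_forall_mem {R : Type} [CommRing R]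
    [IsNoetherianRing R] {N : Type} [AddCommGroup N] [Module R N] [Module.Finite R N]
    {I J : Ideal R} {x : R} (hx : ∀ p ∈ mAss R N, ¬ J ≤ (I + p).radical → x ∈ p) (n : ℕ) :
    x ∈ colonPow ((I ^ n).relIntClosure N) J := by
  classical
  have hfin := Ideal.finite_minimalPrimes_of_isNoetherianRing R (Module.annihilator R N)
  set s := hfin.toFinset
  have hk : ∀ q : Ideal R, ∃ k : ℕ, J ≤ (I + q).radical → J ^ k ≤ I ^ n + q := fun q ↦ by
    by_cases h : J ≤ (I + q).radical
    · have hle : J ≤ (I ^ n + q).radical := by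
        refine h.trans (Ideal.radical_le_radical_iff.mpr (sup_le ?_ ?_))
        · exact fun a ha ↦ ⟨n, Submodule.mem_sup_left (Ideal.pow_mem_pow ha n)⟩
        · exact le_sup_right.trans Ideal.le_radical
      obtain ⟨k, hk⟩ := Ideal.exists_pow_le_of_le_radical_of_fg hle (IsNoetherian.noetherian J)
      exact ⟨k, fun _ ↦ hk⟩
    · exact ⟨0, fun h' ↦ absurd h' h⟩
  choose k hk using hk
  refine ⟨s.sup k + 1, by omega, fun y hy ↦ ?_⟩
  have ha : ∀ q : Ideal R, ∃ a ∈ I ^ n, q ∈ s → x * y - a ∈ q := fun q ↦ by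
    by_cases hq : q ∈ s
    · by_cases h : J ≤ (I + q).radical
      · have hyk : y ∈ I ^ n + q :=
          hk q h (Ideal.pow_le_pow_right ((Finset.le_sup hq).trans (Nat.le_succ _)) hy)
        obtain ⟨a, ha, b, hb, hab⟩ := Submodule.mem_sup.mp (Ideal.mul_mem_left _ x hyk)
        exact ⟨a, ha, fun _ ↦ by rwa [← hab, add_sub_cancel_left]⟩
      · refine ⟨0, zero_mem _, fun _ ↦ ?_⟩
        rw [sub_zero]
        exact Ideal.mul_mem_right _ _ (hx q
          (minimalPrimes_annihilator_subset_mAss N (hfin.mem_toFinset.mp hq)) h)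
    · exact ⟨0, zero_mem _, fun h ↦ absurd h hq⟩
  choose a haI ha using ha
  have hrad : ∏ q ∈ s, (x * y - a q) ∈ (Module.annihilator R N).radical := by
    rw [← Ideal.sInf_minimalPrimes, Submodule.mem_sInf]
    intro q hq
    have hqs : q ∈ s := hfin.mem_toFinset.mpr hq
    exact Ideal.mem_of_dvd _ (Finset.dvd_prod_of_mem _ hqs) (ha q hqs)
  obtain ⟨t, ht⟩ := hrad
  refine Ideal.relIntDep_of_prod_sub_mem_annihilator (s ×ˢ Finset.range t) (fun i ↦ a i.1)
    (fun i _ ↦ haI i.1) ?_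
  simpa [Finset.prod_product, Finset.prod_pow] using ht

/-- `⋂_{n ≥ 1} ((I^n)^{(N)}_a :_R ⟨J⟩) = ⋂ {p ∈ mAss_R N : J ⊄ Rad(I + p)}`. -/
theorem inter_colonPow_relIntClosure_pow_eq {R : Type} [CommRing R] [IsNoetherianRing R]
    (N : Type) [AddCommGroup N] [Module R N] [Module.Finite R N] (I J : Ideal R) :
    (⋂ n ∈ {n : ℕ | 1 ≤ n}, colonPow ((I ^ n).relIntClosure N) J) =
      ⋂ p ∈ {p : Ideal R | p ∈ mAss R N ∧ ¬ J ≤ (I + p).radical}, (p : Set R) := by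
  ext x
  simp only [Set.mem_iInter, Set.mem_ofPred_eq, SetLike.mem_coe]
  exact ⟨fun h p hp ↦ mem_of_forall_mem_colonPow_relIntClosure_pow h hp.1.1 hp.2,
    fun h n _ ↦ mem_colonPow_relIntClosure_of_forall_mem (fun p hp hJ ↦ h p ⟨hp, hJ⟩) n⟩
end

section
/- Let R be a Noetherian commutative ring, I an ideal of R, N a finitely generated R-module, and p ∈ mAss_R N. Then every minimal prime ideal over I + p belongs to A*_a(I, N); that is, there exists n_0 ≥ 1 such that mAss_R R/(I + p) ⊆ Ass_R R/(I^n)^{(N)}_a for all n ≥ n_0. -/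
open Pointwise

section ExtendedRees

open LaurentPolynomial

/-- The extended Rees algebra `D[T⁻¹, P T]` of an ideal `P`. -/
noncomputable def Ideal.extendedRees {D : Type*} [CommRing D] (P : Ideal D) : Subalgebra D D[T;T⁻¹] :=
  Algebra.adjoin D (insert (T (-1)) ((fun a : D => C a * T 1) '' (P : Set D)))

theorem Ideal.coeff_mem_of_mem_extendedRees {D : Type*} [CommRing D] {P : Ideal D}
    {f : D[T;T⁻¹]} (hf : f ∈ P.extendedRees) (n : ℤ) : f.coeff n ∈ P ^ n.toNat := by
  classical
  revert n
  induction hf using Algebra.adjoin_induction with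
  | mem x hx =>
    intro n
    rcases hx with rfl | ⟨a, ha, rfl⟩
    · rw [T_apply]
      split_ifs with h
      · subst h; simp
      · exact zero_mem _
    · dsimp only
      rw [← single_eq_C_mul_T, AddMonoidAlgebra.coeff_single, Finsupp.single_apply]
      split_ifs with h
      · subst h; simpa using ha
      · exact zero_mem _
  | algebraMap r =>
    intro n
    rw [← C_eq_algebraMap, C_apply]
    split_ifs with h
    · subst h; simp
    · exact zero_mem _
  | add x y _ _ hx hy =>
    intro n
    exact add_mem (hx n) (hy n)
  | mul x y _ _ hx hy =>
    intro n
    rw [AddMonoidAlgebra.coeff_mul]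
    refine Submodule.sum_mem _ fun i _ => Submodule.sum_mem _ fun j _ => ?_
    dsimp only
    split_ifs with h
    · subst h
      refine Ideal.pow_le_pow_right (n := i.toNat + j.toNat) (by omega) ?_
      rw [pow_add]
      exact Ideal.mul_mem_mul (hx i) (hy j)
    · exact zero_mem _

theorem Ideal.extendedRees_fg {D : Type*} [CommRing D] {P : Ideal D} (hP : P.FG) :
    P.extendedRees.FG := by
  classical
  obtain ⟨s, rfl⟩ := hP
  refine ⟨insert (T (-1)) (s.image fun a : D => C a * T 1), le_antisymm ?_ ?_⟩
  · refine Algebra.adjoin_mono ?_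
    rw [Finset.coe_insert, Finset.coe_image]
    exact Set.insert_subset_insert (Set.image_mono Submodule.subset_span)
  · refine Algebra.adjoin_le (Set.insert_subset (Algebra.subset_adjoin (by simp)) ?_)
    rintro _ ⟨a, ha, rfl⟩
    refine Submodule.span_induction (fun a ha => ?_) ?_ (fun a b _ _ ha hb => ?_)
      (fun r a _ ha => ?_) (SetLike.mem_coe.1 ha)
    · exact Algebra.subset_adjoin (by simpa using Or.inr ⟨a, ha, rfl⟩)
    · simp
    · simpa [add_mul] using add_mem ha hb
    · have := Subalgebra.smul_mem _ ha r
      rwa [LaurentPolynomial.smul_eq_C_mul, ← mul_assoc, ← map_mul] at this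

/-- An ideal `P` of a Noetherian domain `D` extends to a subideal of a principal ideal `(u)` in
a larger Noetherian domain in such a way that `(u)` contracts into `P`. -/
theorem Ideal.exists_map_le_span_singleton.{u} {D : Type u} [CommRing D] [IsDomain D]
    [IsNoetherianRing D] (P : Ideal D) :
    ∃ (B : Type u) (_ : CommRing B) (_ : IsDomain B) (_ : IsNoetherianRing B) (φ : D →+* B)
      (u : B), Function.Injective φ ∧ u ≠ 0 ∧ P.map φ ≤ Ideal.span {u} ∧
        (Ideal.span {u}).comap φ ≤ P := by
  have hnzd : NoZeroDivisors D[T;T⁻¹] := by unfold LaurentPolynomial; infer_instance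
  have hdom : IsDomain D[T;T⁻¹] := NoZeroDivisors.to_isDomain _
  have hu : (T (-1) : D[T;T⁻¹]) ∈ P.extendedRees := Algebra.subset_adjoin (by simp)
  refine ⟨P.extendedRees, inferInstance, inferInstance,
    isNoetherianRing_of_fg (P.extendedRees_fg (IsNoetherian.noetherian P)),
    algebraMap D P.extendedRees, ⟨T (-1), hu⟩, fun a b hab => ?_, fun h => ?_, ?_, ?_⟩
  · have h := congrArg (fun f : P.extendedRees => (f : D[T;T⁻¹]).coeff 0) hab
    change (algebraMap D D[T;T⁻¹] a).coeff 0 = (algebraMap D D[T;T⁻¹] b).coeff 0 at h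
    simpa [← C_eq_algebraMap] using h
  · exact (isUnit_T (R := D) (-1)).ne_zero (congrArg Subtype.val h)
  · rw [Ideal.map_le_iff_le_comap]
    intro a ha
    refine Ideal.mem_span_singleton.2 ⟨⟨C a * T 1, Algebra.subset_adjoin
      (Set.mem_insert_of_mem _ ⟨a, ha, rfl⟩)⟩, Subtype.ext ?_⟩
    change algebraMap D D[T;T⁻¹] a = T (-1) * (C a * T 1)
    rw [mul_left_comm, ← T_add, ← C_eq_algebraMap]
    simp
  · intro a ha
    obtain ⟨⟨b, hb⟩, hab⟩ := Ideal.mem_span_singleton.1 (Ideal.mem_comap.1 ha)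
    have h : algebraMap D D[T;T⁻¹] a = T (-1) * b := congrArg Subtype.val hab
    have hC : b = C a * T 1 := by
      rw [C_eq_algebraMap, h, mul_right_comm, ← T_add]
      simp
    have := Ideal.coeff_mem_of_mem_extendedRees hb 1
    rw [hC, ← single_eq_C_mul_T, AddMonoidAlgebra.coeff_single] at this
    simpa using this

end ExtendedRees

/-- In a Noetherian ring, a minimal prime `q` over `K` becomes contained in the radical of `K`
after multiplication by some element outside `q`. -/
theorem Ideal.exists_span_singleton_mul_le_radical {R : Type*} [CommRing R] [IsNoetherianRing R]
    {K q : Ideal R} (hq : q ∈ K.minimalPrimes) :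
    ∃ c ∉ q, Ideal.span {c} * q ≤ K.radical := by
  classical
  have hfin : (K.minimalPrimes \ {q}).Finite :=
    (Ideal.finite_minimalPrimes_of_isNoetherianRing R K).sdiff
  have hprime : q.IsPrime := hq.1.1
  have hnot : ¬ hfin.toFinset.inf id ≤ q := by
    rw [hprime.inf_le']
    rintro ⟨q', hq', hle⟩
    simp only [Set.Finite.mem_toFinset, Set.mem_sdiff, Set.mem_singleton_iff] at hq'
    exact hq'.2 (le_antisymm hle (hq.2 hq'.1.1 hle))
  obtain ⟨c, hc, hcq⟩ := Set.not_subset.1 hnot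
  refine ⟨c, hcq, ?_⟩
  rw [← Ideal.sInf_minimalPrimes, le_sInf_iff]
  intro q' hq'
  by_cases h : q' = q
  · exact h ▸ Ideal.mul_le_right
  · refine Ideal.mul_le_left.trans ((Ideal.span_singleton_le_iff_mem _).2 ?_)
    exact (Finset.inf_le (f := id) (by simp [hq', h]) : hfin.toFinset.inf id ≤ q') hc

/-- A nonzero element of a Noetherian domain, even up to factors outside a prime `P`, is not
integral over high powers of `P`. -/
theorem Ideal.exists_forall_pow_notMem_mul_sup_pow {D : Type*} [CommRing D] [IsDomain D]
    [IsNoetherianRing D] (P : Ideal D) [P.IsPrime] {c : D} (hc : c ≠ 0) :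
    ∃ k : ℕ, ∀ n, k < n → ∀ s ∉ P, ∀ m : ℕ,
      (c * s) ^ (m + 1) ∉ P ^ n * (P ^ n ⊔ Ideal.span {c * s}) ^ m := by
  obtain ⟨B, _, _, _, φ, u, hφ, hu, hmap, hcomap⟩ := P.exists_map_le_span_singleton
  obtain ⟨Q', hQ', huQ', hdisj⟩ := Ideal.exists_le_prime_disjoint (Ideal.span {u})
    (P.primeCompl.map (φ : D →* B)) (by
      rw [Set.disjoint_left]
      rintro _ hx ⟨s, hs, rfl⟩
      exact hs (hcomap hx))
  obtain ⟨Q, hQ, hQQ'⟩ := Ideal.exists_minimalPrimes_le huQ'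
  have hQp : Q.IsPrime := hQ.1.1
  have huQ : u ∈ Q := hQ.1.2 (Ideal.mem_span_singleton_self u)
  have hsQ : ∀ s ∉ P, φ s ∉ Q := fun s hs h =>
    Set.disjoint_left.1 hdisj (hQQ' h) ⟨s, hs, rfl⟩
  have hc' : φ c ≠ 0 := (map_ne_zero_iff φ hφ).2 hc
  obtain ⟨f, hf, k, e, hk⟩ : ∃ f ∉ Q, ∃ (k : ℕ) (e : B), f * u ^ k = φ c * e := by
    by_cases hcQ : φ c ∈ Q
    · have hmin : Q ∈ (Ideal.span {φ c}).minimalPrimes := by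
        refine Ideal.mem_minimalPrimes_of_height_le
          ((Ideal.span_singleton_le_iff_mem _).2 hcQ) ?_
        rw [Ideal.height_span_singleton_eq_one_of_mem_nonZeroDivisors
          (mem_nonZeroDivisors_of_ne_zero hc') fun h => hQp.ne_top (Q.eq_top_of_isUnit_mem hcQ h)]
        exact Ideal.height_le_one_of_isPrincipal_of_mem_minimalPrimes _ Q hQ
      obtain ⟨g, hg, hle⟩ := Ideal.exists_span_singleton_mul_le_radical hmin
      obtain ⟨k, hk⟩ := hle (Ideal.mul_mem_mul (Ideal.mem_span_singleton_self g) huQ)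
      obtain ⟨e, he⟩ := Ideal.mem_span_singleton.1 hk
      exact ⟨g ^ k, fun h => hg (hQp.mem_of_pow_mem _ h), k, e, by rw [← mul_pow, he]⟩
    · exact ⟨φ c, hcQ, 0, 1, by simp⟩
  refine ⟨k, fun n hn s hs m hmem => ?_⟩
  have hP : (P ^ n).map φ ≤ Ideal.span {u} ^ n := by
    rw [Ideal.map_pow]; exact Ideal.pow_right_mono hmap n
  have hP' : Ideal.span {u} ^ n ≤ Ideal.span {u} ^ (k + 1) := Ideal.pow_le_pow_right hn
  have h₁ := Ideal.mem_map_of_mem φ hmem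
  rw [Ideal.map_mul, Ideal.map_pow _ (P ^ n ⊔ _), Ideal.map_sup, Ideal.map_span, Set.image_singleton,
    map_pow] at h₁
  have he : e * φ (c * s) = f * φ s * u ^ k := by
    rw [map_mul]; linear_combination (-φ s) * hk
  have h₂ : (f * φ s * u ^ k) ^ (m + 1) ∈ Ideal.span {u} ^ (k + 1) * (Ideal.span {u} ^ k) ^ m := by
    rw [← he, mul_pow]
    have h₃ := Ideal.mul_mem_mul
      (Ideal.pow_mem_pow (Ideal.mem_span_singleton_self e) m) h₁
    rw [mul_left_comm, ← mul_pow] at h₃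
    rw [pow_succ e, mul_right_comm]
    refine Ideal.mul_mem_right _ _ (Ideal.mul_mono (hP.trans hP') (Ideal.pow_right_mono ?_ m) h₃)
    rw [Ideal.mul_sup, sup_le_iff, Ideal.span_singleton_mul_span_singleton, he,
      Ideal.span_singleton_le_iff_mem, Ideal.span_singleton_pow]
    refine ⟨Ideal.mul_le_right.trans (hP.trans (hP'.trans ?_)), ?_⟩
    · rw [← Ideal.span_singleton_pow]
      exact Ideal.pow_le_pow_right k.le_succ
    · exact Ideal.mul_mem_left _ _ (Ideal.mem_span_singleton_self _)
  rw [← pow_mul, ← pow_add, Ideal.span_singleton_pow, Ideal.mem_span_singleton] at h₂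
  obtain ⟨w, hw⟩ := h₂
  have h₄ : (f * φ s) ^ (m + 1) = u * w := by
    refine mul_right_cancel₀ (pow_ne_zero (k * (m + 1)) hu) ?_
    calc _ = (f * φ s * u ^ k) ^ (m + 1) := by ring
      _ = u ^ (k + 1 + k * m) * w := hw
      _ = _ := by ring
  have h₅ := hQp.mem_of_pow_mem _ (h₄ ▸ Ideal.mul_mem_right _ _ huQ : (f * φ s) ^ (m + 1) ∈ Q)
  exact (hQp.mem_or_mem h₅).elim hf (hsQ s hs)

section RelIntClosure

variable {R : Type} [CommRing R] {N : Type} [AddCommGroup N] [Module R N]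

theorem Ideal.sup_span_singleton_pow_le (I : Ideal R) (x : R) (n : ℕ) :
    (I ⊔ Ideal.span {x}) ^ n ≤ ⨆ i ∈ Finset.range (n + 1), I ^ i * Ideal.span {x ^ (n - i)} := by
  rw [← Ideal.add_eq_sup, add_pow, Ideal.sum_eq_sup, Finset.sup_eq_iSup]
  refine iSup₂_mono fun i _ => ?_
  rw [Ideal.span_singleton_pow]
  exact Ideal.mul_le_left

theorem Ideal.pow_mul_pow_le_sup_pow (A B : Ideal R) (i j : ℕ) :
    A ^ i * B ^ j ≤ (A ⊔ B) ^ (i + j) := by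
  rw [pow_add]
  exact Ideal.mul_mono (Ideal.pow_right_mono le_sup_left i) (Ideal.pow_right_mono le_sup_right j)

theorem Ideal.relIntDep_iff_exists_smul_mem (I : Ideal R) (x : R) :
    I.RelIntDep N x ↔ ∃ n : ℕ, ∀ m : N,
      x ^ (n + 1) • m ∈ (I * (I ⊔ Ideal.span {x}) ^ n) • (⊤ : Submodule R N) := by
  have key (n : ℕ) : ⨆ i ∈ Finset.Icc 1 (n + 1),
        x ^ (n + 1 - i) • (I ^ i • (⊤ : Submodule R N)) =
      (I * (I ⊔ Ideal.span {x}) ^ n) • (⊤ : Submodule R N) := by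
    apply le_antisymm
    · refine iSup₂_le fun i hi => ?_
      obtain ⟨hi1, hi2⟩ := Finset.mem_Icc.1 hi
      obtain ⟨j, rfl⟩ := Nat.exists_eq_add_of_le' hi1
      rw [← Submodule.ideal_span_singleton_smul, ← Submodule.mul_smul]
      refine Submodule.smul_mono_left ?_
      have hn : n = j + (n + 1 - (j + 1)) := by omega
      rw [← Ideal.span_singleton_pow, pow_succ' I, mul_left_comm, mul_comm (_ ^ _)]
      conv_rhs => rw [hn, pow_add]
      exact Ideal.mul_mono_right (Ideal.mul_mono (Ideal.pow_right_mono le_sup_left _)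
        (Ideal.pow_right_mono le_sup_right _))
    · refine (Submodule.smul_mono_left (Ideal.mul_mono_right
        (I.sup_span_singleton_pow_le x n))).trans ?_
      simp_rw [Ideal.mul_iSup, Submodule.iSup_smul]
      refine iSup₂_le fun i hi => ?_
      refine le_iSup₂_of_le (i + 1) (by simpa using hi) ?_
      rw [← Submodule.ideal_span_singleton_smul, ← Submodule.mul_smul, ← mul_assoc,
        ← pow_succ', mul_comm, Nat.add_sub_add_right]
  constructor
  · rintro ⟨n, hn, h⟩
    obtain ⟨n, rfl⟩ := Nat.exists_eq_add_of_le' hn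
    exact ⟨n, fun m => key n ▸ h m⟩
  · rintro ⟨n, h⟩
    exact ⟨n + 1, n.succ_pos, fun m => (key n).symm ▸ h m⟩

theorem Ideal.exists_pow_add_smul_eq_zero [IsNoetherianRing R] [Module.Finite R N] (I : Ideal R)
    {x : R} {M : Submodule R N} (h : Ideal.span {x} • M ≤ I • M) :
    ∃ d : ℕ, ∃ g ∈ I * (I ⊔ Ideal.span {x}) ^ d, ∀ m ∈ M, (x ^ (d + 1) + g) • m = 0 := by
  have hM : LinearMap.range (LinearMap.lsmul R M x) ≤ I • (⊤ : Submodule R M) := by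
    rintro _ ⟨m, rfl⟩
    rw [Submodule.mem_smul_top_iff]
    exact h (Submodule.smul_mem_smul (Ideal.mem_span_singleton_self x) m.2)
  obtain ⟨f, hf, -, hcoeff, hf0⟩ :=
    LinearMap.exists_monic_and_natDegree_eq_and_coeff_mem_pow_and_aeval_eq_zero
      R (LinearMap.lsmul R M x) I hM
  refine ⟨f.natDegree, x * ∑ i ∈ Finset.range f.natDegree, f.coeff i * x ^ i, ?_, ?_⟩
  · rw [Finset.mul_sum]
    refine Submodule.sum_mem _ fun i hi => ?_
    have hi := Finset.mem_range.1 hi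
    obtain ⟨j, hj⟩ := Nat.exists_eq_add_of_lt hi
    have hc := hcoeff i
    rw [show f.natDegree - i = j + 1 by omega, pow_succ'] at hc
    rw [mul_left_comm, ← pow_succ', hj, add_right_comm, add_comm _ j, pow_add, ← mul_assoc]
    exact Ideal.mul_mono (Ideal.mul_mono_right (Ideal.pow_right_mono le_sup_left _))
      (Ideal.pow_right_mono le_sup_right _)
      (Ideal.mul_mem_mul hc (Ideal.pow_mem_pow (Ideal.mem_span_singleton_self x) _))
  · intro m hm
    have heval : (f.eval x) • m = 0 := by
      have h₁ : LinearMap.lsmul R M x = algebraMap R (Module.End R M) x := rfl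
      rw [h₁, Polynomial.aeval_algebraMap_apply, Polynomial.coe_aeval_eq_eval] at hf0
      exact congrArg Subtype.val (LinearMap.congr_fun hf0 ⟨m, hm⟩)
    have h₂ : x ^ (f.natDegree + 1) + x * ∑ i ∈ Finset.range f.natDegree, f.coeff i * x ^ i =
        x * f.eval x := by
      rw [Polynomial.eval_eq_sum_range, Finset.sum_range_succ, hf.coeff_natDegree]
      ring
    rw [h₂, mul_smul, heval, smul_zero]

theorem Ideal.exists_mem_annihilator_sup [IsNoetherianRing R] [Module.Finite R N] (I : Ideal R)
    {x : R} {M : Submodule R N} (h : Ideal.span {x} • M ≤ I • M) {k : ℕ}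
    (hk : ∀ m : N, x ^ k • m ∈ M) :
    ∃ n : ℕ, x ^ (n + 1) ∈ Module.annihilator R N ⊔ I * (I ⊔ Ideal.span {x}) ^ n := by
  obtain ⟨d, g, hg, h0⟩ := I.exists_pow_add_smul_eq_zero h
  refine ⟨d + k, ?_⟩
  have hann : (x ^ (d + 1) + g) * x ^ k ∈ Module.annihilator R N :=
    Module.mem_annihilator.2 fun m => by rw [mul_smul]; exact h0 _ (hk m)
  have hgk : g * x ^ k ∈ I * (I ⊔ Ideal.span {x}) ^ (d + k) := by
    rw [pow_add, ← mul_assoc]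
    exact Ideal.mul_mem_mul hg (Ideal.pow_mem_pow
      (le_sup_right (a := I) (Ideal.mem_span_singleton_self x)) k)
  rw [show x ^ (d + k + 1) = (x ^ (d + 1) + g) * x ^ k - g * x ^ k by ring]
  exact sub_mem (Ideal.mem_sup_left hann) (Ideal.mem_sup_right hgk)

theorem Ideal.relIntDep_of_mem_annihilator_sup (I : Ideal R) {x : R} {n : ℕ}
    (h : x ^ (n + 1) ∈ Module.annihilator R N ⊔ I * (I ⊔ Ideal.span {x}) ^ n) :
    I.RelIntDep N x := by
  refine (I.relIntDep_iff_exists_smul_mem x).2 ⟨n, fun m => ?_⟩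
  obtain ⟨a, ha, b, hb, hab⟩ := Submodule.mem_sup.1 h
  rw [← hab, add_smul, Module.mem_annihilator.1 ha, zero_add]
  exact Submodule.smul_mem_smul hb trivial

theorem Ideal.RelIntDep.smul_le {I : Ideal R} {x : R} {n : ℕ}
    (h : ∀ m : N, x ^ (n + 1) • m ∈ (I * (I ⊔ Ideal.span {x}) ^ n) • (⊤ : Submodule R N)) :
    (I ⊔ Ideal.span {x}) ^ (n + 1) • (⊤ : Submodule R N) ≤
      (I * (I ⊔ Ideal.span {x}) ^ n) • (⊤ : Submodule R N) := by
  refine (Submodule.smul_mono_left (I.sup_span_singleton_pow_le x (n + 1))).trans ?_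
  simp_rw [Submodule.iSup_smul]
  refine iSup₂_le fun i hi => ?_
  rcases i with _ | j
  · rw [pow_zero, one_mul, Submodule.ideal_span_singleton_smul]
    rintro _ ⟨m, -, rfl⟩
    exact h m
  · refine Submodule.smul_mono_left ?_
    have hj : n = j + (n + 1 - (j + 1)) := by have := Finset.mem_range.1 hi; omega
    rw [pow_succ' I, mul_assoc, ← Ideal.span_singleton_pow]
    conv_rhs => rw [hj, pow_add]
    exact Ideal.mul_mono_right (Ideal.mul_mono (Ideal.pow_right_mono le_sup_left _)
      (Ideal.pow_right_mono le_sup_right _))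

theorem Ideal.RelIntDep.exists_mem_annihilator_sup [IsNoetherianRing R] [Module.Finite R N]
    {I : Ideal R} {x : R} (h : I.RelIntDep N x) :
    ∃ n : ℕ, x ^ (n + 1) ∈ Module.annihilator R N ⊔ I * (I ⊔ Ideal.span {x}) ^ n := by
  obtain ⟨n, hn⟩ := (I.relIntDep_iff_exists_smul_mem x).1 h
  refine I.exists_mem_annihilator_sup (M := (I ⊔ Ideal.span {x}) ^ n • ⊤) (k := n) ?_ fun m => ?_
  · rw [← Submodule.mul_smul, ← Submodule.mul_smul]
    refine (Submodule.smul_mono_left ?_).trans (Ideal.RelIntDep.smul_le hn)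
    rw [pow_succ']
    exact Ideal.mul_mono_left le_sup_right
  · exact Submodule.smul_mem_smul (Ideal.pow_mem_pow
      (le_sup_right (a := I) (Ideal.mem_span_singleton_self x)) n) trivial

theorem Ideal.RelIntDep.add [IsNoetherianRing R] [Module.Finite R N]
    {I : Ideal R} {x y : R} (hx : I.RelIntDep N x) (hy : I.RelIntDep N y) :
    I.RelIntDep N (x + y) := by
  obtain ⟨n, hn⟩ := (I.relIntDep_iff_exists_smul_mem x).1 hx
  obtain ⟨m, hm⟩ := (I.relIntDep_iff_exists_smul_mem y).1 hy
  replace hn := Ideal.RelIntDep.smul_le hn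
  replace hm := Ideal.RelIntDep.smul_le hm
  set A := I ⊔ Ideal.span {x}
  set B := I ⊔ Ideal.span {y}
  have hxy : x + y ∈ A ⊔ B := add_mem
    (Ideal.mem_sup_left (Ideal.mem_sup_right (Ideal.mem_span_singleton_self x)))
    (Ideal.mem_sup_right (Ideal.mem_sup_right (Ideal.mem_span_singleton_self y)))
  have hpow : (A ⊔ B) ^ (n + m + 1) • (⊤ : Submodule R N) ≤
      (I * (A ⊔ B) ^ (n + m)) • (⊤ : Submodule R N) := by
    have hle : (A ⊔ B) ^ (n + m + 1) ≤
        A ^ (n + 1) * (A ⊔ B) ^ m ⊔ B ^ (m + 1) * (A ⊔ B) ^ n := by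
      rw [← Ideal.add_eq_sup, add_pow, Ideal.sum_eq_sup, Ideal.add_eq_sup]
      refine Finset.sup_le fun i hi => Ideal.mul_le_left.trans ?_
      have hi := Finset.mem_range.1 hi
      obtain ⟨j, hj⟩ := Nat.exists_eq_add_of_le (Nat.lt_succ_iff.1 hi)
      rw [hj, Nat.add_sub_cancel_left]
      rcases Nat.lt_or_ge n i with h | h
      · obtain ⟨l, rfl⟩ := Nat.exists_eq_add_of_le h
        refine le_sup_of_le_left ?_
        rw [pow_add A, mul_assoc, show m = l + j by omega]
        exact Ideal.mul_mono_right (Ideal.pow_mul_pow_le_sup_pow A B l j)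
      · obtain ⟨l, rfl⟩ := Nat.exists_eq_add_of_le (show m + 1 ≤ j by omega)
        refine le_sup_of_le_right ?_
        rw [pow_add B, mul_left_comm, show n = i + l by omega]
        exact Ideal.mul_mono_right (Ideal.pow_mul_pow_le_sup_pow A B i l)
    refine (Submodule.smul_mono_left hle).trans ?_
    rw [Submodule.sup_smul, sup_le_iff]
    constructor
    · rw [mul_comm, Submodule.mul_smul]
      refine (Submodule.smul_mono le_rfl hn).trans ?_
      rw [← Submodule.mul_smul]
      refine Submodule.smul_mono_left ?_
      rw [mul_left_comm, add_comm n m, pow_add]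
      exact Ideal.mul_mono_right (Ideal.mul_mono_right (Ideal.pow_right_mono le_sup_left _))
    · rw [mul_comm, Submodule.mul_smul]
      refine (Submodule.smul_mono le_rfl hm).trans ?_
      rw [← Submodule.mul_smul]
      refine Submodule.smul_mono_left ?_
      rw [mul_left_comm, pow_add]
      exact Ideal.mul_mono_right (Ideal.mul_mono_right (Ideal.pow_right_mono le_sup_right _))
  obtain ⟨k, hk⟩ := I.exists_mem_annihilator_sup (N := N) (x := x + y)
    (M := (A ⊔ B) ^ (n + m) • ⊤) (k := n + m) (by
      rw [← Submodule.mul_smul, ← Submodule.mul_smul]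
      refine (Submodule.smul_mono_left ?_).trans hpow
      rw [pow_succ']
      exact Ideal.mul_mono_left ((Ideal.span_singleton_le_iff_mem _).2 hxy))
    fun v => Submodule.smul_mem_smul (Ideal.pow_mem_pow hxy _) trivial
  exact I.relIntDep_of_mem_annihilator_sup hk

theorem Ideal.RelIntDep.mul_left [IsNoetherianRing R] [Module.Finite R N]
    {I : Ideal R} {x : R} (hx : I.RelIntDep N x) (r : R) : I.RelIntDep N (r * x) := by
  obtain ⟨n, hn⟩ := hx.exists_mem_annihilator_sup
  refine I.relIntDep_of_mem_annihilator_sup (n := n) ?_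
  have h := Ideal.mul_mem_mul
    (Ideal.pow_mem_pow (Ideal.mem_span_singleton_self r) (n + 1)) hn
  rw [← mul_pow, Ideal.mul_sup] at h
  refine (sup_le_sup Ideal.mul_le_right ?_ : _ ≤ (_ : Ideal R)) h
  rw [mul_left_comm, pow_succ, mul_right_comm, ← mul_pow]
  refine Ideal.mul_mono_right (Ideal.mul_le_left.trans (Ideal.pow_right_mono ?_ n))
  rw [Ideal.mul_sup, Ideal.span_singleton_mul_span_singleton]
  exact sup_le_sup_right Ideal.mul_le_right _

variable (N) in
/-- The integral closure of `I` relative to `N`, as an ideal. -/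
def Ideal.relIntClosureIdeal [IsNoetherianRing R] [Module.Finite R N] (I : Ideal R) : Ideal R where
  carrier := I.relIntClosure N
  add_mem' := Ideal.RelIntDep.add
  zero_mem' := ⟨1, one_pos, by simp⟩
  smul_mem' r _ hx := Ideal.RelIntDep.mul_left hx r

theorem Ideal.le_relIntClosureIdeal [IsNoetherianRing R] [Module.Finite R N] (I : Ideal R) :
    I ≤ I.relIntClosureIdeal N := fun x hx =>
  I.relIntDep_of_mem_annihilator_sup (n := 0) (Ideal.mem_sup_right (by simpa using hx))

theorem Ideal.radical_annihilator_le_relIntClosureIdeal [IsNoetherianRing R] [Module.Finite R N]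
    (I : Ideal R) : (Module.annihilator R N).radical ≤ I.relIntClosureIdeal N := by
  rintro x ⟨n, hn⟩
  refine I.relIntDep_of_mem_annihilator_sup (n := n) (Ideal.mem_sup_left ?_)
  rw [pow_succ]
  exact Ideal.mul_mem_right _ _ hn

end RelIntClosure

theorem mem_minimalPrimes_annihilator_of_mem_mAss {R : Type} [CommRing R] [IsNoetherianRing R]
    {N : Type} [AddCommGroup N] [Module R N] [Module.Finite R N] {p : Ideal R} (hp : p ∈ mAss R N) :
    p ∈ (Module.annihilator R N).minimalPrimes := by
  have hass : IsAssociatedPrime p N := hp.prop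
  have := hass.isPrime
  obtain ⟨q, hq, hqp⟩ := Ideal.exists_minimalPrimes_le
    (Submodule.annihilator_top.symm.trans_le hass.annihilator_le)
  have hqass := Module.associatedPrimes.minimalPrimes_annihilator_subset_associatedPrimes R N hq
  rwa [le_antisymm (hp.le_of_le hqass hqp) hqp]

/-- For `c` outside a prime `p ⊇ Ann N` and `P ⊇ I + p` a prime, the elements `c * s` with `s`
outside `P` are not integral over high powers of `I` relative to `N`. -/
theorem Ideal.exists_forall_not_relIntDep_pow {R : Type} [CommRing R] [IsNoetherianRing R]
    {N : Type} [AddCommGroup N] [Module R N] [Module.Finite R N] {I p P : Ideal R} [p.IsPrime]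
    [P.IsPrime] (hann : Module.annihilator R N ≤ p) (hIP : I ≤ P) (hpP : p ≤ P)
    {c : R} (hc : c ∉ p) :
    ∃ k : ℕ, ∀ n, k < n → ∀ s ∉ P, ¬ (I ^ n).RelIntDep N (c * s) := by
  have hcomap : (P.map (Ideal.Quotient.mk p)).comap (Ideal.Quotient.mk p) = P := by
    rw [Ideal.comap_map_of_surjective _ Ideal.Quotient.mk_surjective, ← RingHom.ker_eq_comap_bot,
      Ideal.mk_ker, sup_eq_left.2 hpP]
  have hprime : (P.map (Ideal.Quotient.mk p)).IsPrime :=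
    Ideal.map_isPrime_of_surjective Ideal.Quotient.mk_surjective (by rwa [Ideal.mk_ker])
  obtain ⟨k, hk⟩ := (P.map (Ideal.Quotient.mk p)).exists_forall_pow_notMem_mul_sup_pow
    (c := Ideal.Quotient.mk p c) (by rwa [Ne, Ideal.Quotient.eq_zero_iff_mem])
  refine ⟨k, fun n hn s hs hdep => ?_⟩
  obtain ⟨m, hm⟩ := hdep.exists_mem_annihilator_sup
  refine hk n hn (Ideal.Quotient.mk p s) (fun h => hs (hcomap ▸ h)) m ?_
  have h := Ideal.mem_map_of_mem (Ideal.Quotient.mk p) hm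
  have hI : (I ^ n).map (Ideal.Quotient.mk p) ≤ P.map (Ideal.Quotient.mk p) ^ n := by
    rw [Ideal.map_pow]
    exact Ideal.pow_right_mono (Ideal.map_mono hIP) n
  rw [Ideal.map_sup, (Ideal.map_eq_bot_iff_le_ker _).2 (hann.trans_eq Ideal.mk_ker.symm),
    bot_sup_eq, Ideal.map_mul, Ideal.map_pow _ (I ^ n ⊔ _), Ideal.map_sup, Ideal.map_span,
    Set.image_singleton, map_pow, map_mul] at h
  exact Ideal.mul_mono hI (Ideal.pow_right_mono (sup_le_sup_right hI _) m) h

/-- A prime `P` is associated to `R / J` if it contains `(J : x)` and a power of it lies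
in `(J : x)`. -/
theorem Ideal.mem_assQuot_of_pow_le {R : Type} [CommRing R] [IsNoetherianRing R] {J P : Ideal R}
    [P.IsPrime] {x : R} (hle : ∀ t, t * x ∈ J → t ∈ P) {k : ℕ} (hpow : ∀ y ∈ P ^ k, y * x ∈ J) :
    P ∈ assQuot (J : Set R) := by
  let K : Ideal R := Submodule.comap (LinearMap.toSpanSingleton R R x) J
  have hK : ∀ t, t ∈ K ↔ t * x ∈ J := fun t => Iff.rfl
  have hmin : P ∈ K.minimalPrimes := by
    refine ⟨⟨inferInstance, fun t ht => hle t ((hK t).1 ht)⟩, fun q hq _ => ?_⟩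
    exact fun y hy => hq.1.mem_of_pow_mem k (hq.2 ((hK _).2 (hpow _ (Ideal.pow_mem_pow hy k))))
  have hmem : P ∈ associatedPrimes R (R ⧸ K) := by
    apply Module.associatedPrimes.minimalPrimes_annihilator_subset_associatedPrimes
    rwa [Ideal.annihilator_quotient]
  obtain ⟨-, y, hy⟩ := isAssociatedPrime_iff.1 hmem
  obtain ⟨y, rfl⟩ := Ideal.Quotient.mk_surjective y
  refine ⟨inferInstance, y * x, Set.ext fun r => ?_⟩
  rw [SetLike.mem_coe, hy, Submodule.mem_colon_singleton, Submodule.mem_bot, Set.mem_ofPred_eq,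
    ← mul_assoc, SetLike.mem_coe, ← hK, ← Ideal.Quotient.eq_zero_iff_mem]
  rfl

/-- For `p ∈ mAss_R N`, every minimal prime over `I + p` belongs to `A*_a(I, N)`:
there is `n₀ ≥ 1` with `mAss_R R/(I + p) ⊆ Ass_R R/(I^n)^{(N)}_a` for all `n ≥ n₀`. -/
theorem minimalPrimes_add_subset_assQuot_relIntClosure {R : Type} [CommRing R]
    [IsNoetherianRing R] (N : Type) [AddCommGroup N] [Module R N] [Module.Finite R N]
    (I : Ideal R) (p : Ideal R) (hp : p ∈ mAss R N) :
    ∃ n₀ : ℕ, 1 ≤ n₀ ∧ ∀ n : ℕ, n₀ ≤ n →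
      (I + p).minimalPrimes ⊆ assQuot ((I ^ n).relIntClosure N) := by
  have hpmin := mem_minimalPrimes_annihilator_of_mem_mAss hp
  have hpp : p.IsPrime := hpmin.1.1
  obtain ⟨c, hc, hcp⟩ := Ideal.exists_span_singleton_mul_le_radical hpmin
  have hev : ∀ᶠ n in Filter.atTop, ∀ P ∈ (I + p).minimalPrimes,
      P ∈ assQuot ((I ^ n).relIntClosure N) := by
    refine (Filter.eventually_all_finite
      (Ideal.finite_minimalPrimes_of_isNoetherianRing R (I + p))).2 fun P hP => ?_
    have hPp : P.IsPrime := hP.1.1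
    have hIpP : I ⊔ p ≤ P := hP.1.2
    obtain ⟨k, hk⟩ := Ideal.exists_forall_not_relIntDep_pow (N := N) hpmin.1.2
      (le_sup_left.trans hIpP) (le_sup_right.trans hIpP) hc
    obtain ⟨s, hs, hsP⟩ := Ideal.exists_span_singleton_mul_le_radical hP
    obtain ⟨m, hm⟩ := Ideal.exists_pow_le_of_le_radical_of_fg hsP (IsNoetherian.noetherian _)
    filter_upwards [Filter.eventually_gt_atTop k] with n hn
    refine Ideal.mem_assQuot_of_pow_le (J := (I ^ n).relIntClosureIdeal N)
      (x := c * s ^ (m * (n + 1))) (k := m * (n + 1)) (fun t ht => ?_) fun y hy => ?_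
    · by_contra htP
      refine hk n hn (t * s ^ (m * (n + 1)))
        (fun h => (hPp.mem_or_mem h).elim htP fun h => hs (hPp.mem_of_pow_mem _ h)) ?_
      rwa [mul_left_comm]
    · have hle : (Ideal.span {s} * P) ^ (m * (n + 1)) ≤ I ^ n ⊔ p := by
        rw [pow_mul]
        refine (Ideal.pow_right_mono hm (n + 1)).trans ?_
        simpa using Ideal.sup_pow_add_le_pow_sup_pow (I := I) (J := p) (n := n) (m := 1)
      have hys : s ^ (m * (n + 1)) * y ∈ I ^ n ⊔ p := by
        refine hle ?_
        rw [mul_pow]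
        exact Ideal.mul_mem_mul (Ideal.pow_mem_pow (Ideal.mem_span_singleton_self s) _) hy
      obtain ⟨a, ha, b, hb, hab⟩ := Submodule.mem_sup.1 hys
      rw [show y * (c * s ^ (m * (n + 1))) = c * a + c * b by rw [← mul_add, hab]; ring]
      exact add_mem (Ideal.mul_mem_left _ _ ((I ^ n).le_relIntClosureIdeal ha))
        ((I ^ n).radical_annihilator_le_relIntClosureIdeal
          (hcp (Ideal.mul_mem_mul (Ideal.mem_span_singleton_self c) hb)))
  obtain ⟨n₀, hn₀⟩ := Filter.eventually_atTop.1 hev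
  exact ⟨max 1 n₀, le_max_left _ _, fun n hn => hn₀ n (le_of_max_le_right hn)⟩
end
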